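/- There is an absolute constant C ≥ 1 such that the following holds. Let p be an odd prime, Γ ⊆ F_p^* a multiplicative subgroup, and k ≥ 2 an integer with 2^{64k} C⁴ ≤ |Γ|. Then T⁺_{2^k}(Γ) ≤ 2^{4k+6} C (log|Γ|)⁴ · |Γ|^{2^{k+1}}/p + 16^{k²} C^{k−1} (log|Γ|)^{4(k−1)} · |Γ|^{2^{k+1} − (k+7)/2} · E⁺(Γ). -/

import Mathlib

open Finset Pointwise

/-- `Γ` is a multiplicative subgroup of `F_p^*` (as a finite set of field elements). -/
def IsMulSubgroup {F : Type*} [Field F] [DecidableEq F] (Γ : Finset F) : Prop :=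
  (0 : F) ∉ Γ ∧ (1 : F) ∈ Γ ∧ (∀ x ∈ Γ, ∀ y ∈ Γ, x * y ∈ Γ) ∧ (∀ x ∈ Γ, x⁻¹ ∈ Γ)

/-- `T⁺_m(A) = #{(a1,…,am,a1',…,am') ∈ A^{2m} : a1+⋯+am = a1'+⋯+am'}`. -/
def Tplus {G : Type*} [AddCommMonoid G] [DecidableEq G] (m : ℕ) (A : Finset G) : ℕ :=
  (((Fintype.piFinset fun _ : Fin m => A) ×ˢ (Fintype.piFinset fun _ : Fin m => A)).filter
    fun x => ∑ i, x.1 i = ∑ i, x.2 i).card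

/-- The additive energy `E⁺(Γ)`. -/
def Eplus {G : Type*} [AddCommGroup G] [DecidableEq G] (Q : Finset G) : ℕ :=
  ((Q ×ˢ Q ×ˢ Q ×ˢ Q).filter fun q => q.1 + q.2.1 = q.2.2.1 + q.2.2.2).card

/-- If every element of `L` has at least `R` neighbours in `L`, a small subset of `L` contains more
than `D` neighbours of each element. -/
theorem exists_small_hitting_subset {α : Type*} [DecidableEq α] (L : Finset α) (N : α → Finset α)
    (hN : ∀ a ∈ L, N a ⊆ L) (D R M : ℕ) (hR : ∀ a ∈ L, R ≤ #(N a)) (hRD : 2 * D ≤ R)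
    (hM : (#L : ℝ) * (1 - R / (4 * #L)) ^ M * 2 ^ D < 1) :
    ∃ S ⊆ L, #S ≤ M ∧ ∀ a ∈ L, D + 1 ≤ #(N a ∩ S) := by
  classical
  rcases L.eq_empty_or_nonempty with rfl | hL
  · exact ⟨∅, by simp⟩
  have hn : (0 : ℝ) < #L := by exact_mod_cast hL.card_pos
  have hRL : (R : ℝ) ≤ #L := by
    obtain ⟨a, ha⟩ := hL
    exact_mod_cast (hR a ha).trans (card_le_card (hN a ha))
  have hc : (0 : ℝ) ≤ 1 - R / (4 * #L) := by
    rw [sub_nonneg, div_le_one (by positivity)]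
    linarith
  let wt : α → Finset α → ℝ := fun a S => if #(N a ∩ S) ≤ D then (1 / 2 : ℝ) ^ #(N a ∩ S) else 0
  have wt_nonneg : ∀ a S, 0 ≤ wt a S := fun a S => by
    simp only [wt]
    split_ifs <;> positivity
  have wt_mono : ∀ a S x, wt a (insert x S) ≤ wt a S := fun a S x => by
    have hle : #(N a ∩ S) ≤ #(N a ∩ insert x S) :=
      card_le_card (inter_subset_inter_left (subset_insert x S))
    simp only [wt]
    split_ifs with h1 h2 h2
    · exact pow_le_pow_of_le_one (by norm_num) (by norm_num) hle
    · omega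
    · positivity
    · exact le_rfl
  have key : ∀ S, ∀ a ∈ L, ∑ x ∈ L, wt a (insert x S) ≤ (#L - R / 4) * wt a S := by
    intro S a ha
    by_cases hD : #(N a ∩ S) ≤ D
    · have hw : wt a S = (1 / 2 : ℝ) ^ #(N a ∩ S) := by simp only [wt, if_pos hD]
      have hsub : N a \ S ⊆ L := sdiff_subset.trans (hN a ha)
      have hcard : (R : ℝ) / 2 ≤ #(N a \ S) := by
        have h1 := card_sdiff_add_card_inter (N a) S
        have h2 := hR a ha
        have h3 : R ≤ 2 * #(N a \ S) := by omega
        have : (R : ℝ) ≤ 2 * #(N a \ S) := by exact_mod_cast h3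
        linarith
      have hgood : ∀ x ∈ N a \ S, wt a (insert x S) ≤ wt a S / 2 := by
        intro x hx
        rw [mem_sdiff] at hx
        have hins : #(N a ∩ insert x S) = #(N a ∩ S) + 1 := by
          rw [inter_insert_of_mem hx.1, card_insert_of_notMem]
          simp [hx.2]
        rw [hw]
        simp only [wt, hins]
        split_ifs
        · rw [pow_succ]; linarith
        · positivity
      rw [← sum_sdiff hsub]
      have h1 : ∑ x ∈ L \ (N a \ S), wt a (insert x S) ≤ #(L \ (N a \ S)) * wt a S := by
        rw [← nsmul_eq_mul]
        exact sum_le_card_nsmul _ _ _ fun x _ => wt_mono a S x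
      have h2 : ∑ x ∈ N a \ S, wt a (insert x S) ≤ #(N a \ S) * (wt a S / 2) := by
        rw [← nsmul_eq_mul]
        exact sum_le_card_nsmul _ _ _ hgood
      have h3 : (#(L \ (N a \ S)) : ℝ) = #L - #(N a \ S) := by
        rw [card_sdiff_of_subset hsub, Nat.cast_sub (card_le_card hsub)]
      rw [h3] at h1
      nlinarith [wt_nonneg a S]
    · have hw : wt a S = 0 := by simp only [wt, if_neg hD]
      rw [hw, mul_zero]
      exact sum_nonpos fun x _ => (wt_mono a S x).trans hw.le
  have step : ∀ i : ℕ, ∃ S ⊆ L, #S ≤ i ∧ ∑ a ∈ L, wt a S ≤ #L * (1 - R / (4 * #L)) ^ i := by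
    intro i
    induction i with
    | zero =>
      refine ⟨∅, empty_subset _, le_rfl, ?_⟩
      simp [wt]
    | succ i ih =>
      obtain ⟨S, hSL, hSi, hS⟩ := ih
      have havg : ∑ x ∈ L, ∑ a ∈ L, wt a (insert x S) ≤
          ∑ x ∈ L, (1 - R / (4 * #L)) * ∑ a ∈ L, wt a S := by
        rw [sum_comm, sum_const, nsmul_eq_mul]
        calc ∑ a ∈ L, ∑ x ∈ L, wt a (insert x S) ≤ ∑ a ∈ L, (#L - R / 4) * wt a S :=
              sum_le_sum (key S)
          _ = #L * ((1 - R / (4 * #L)) * ∑ a ∈ L, wt a S) := by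
              rw [← mul_sum, ← mul_assoc]
              congr 1
              field_simp
      obtain ⟨x, hxL, hx⟩ := exists_le_of_sum_le hL havg
      refine ⟨insert x S, insert_subset hxL hSL, (card_insert_le _ _).trans (by omega), ?_⟩
      calc ∑ a ∈ L, wt a (insert x S) ≤ (1 - R / (4 * #L)) * ∑ a ∈ L, wt a S := hx
        _ ≤ (1 - R / (4 * #L)) * (#L * (1 - R / (4 * #L)) ^ i) :=
            mul_le_mul_of_nonneg_left hS hc
        _ = #L * (1 - R / (4 * #L)) ^ (i + 1) := by ring
  obtain ⟨S, hSL, hSM, hS⟩ := step M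
  refine ⟨S, hSL, hSM, fun a ha => ?_⟩
  by_contra hlt
  have hD : #(N a ∩ S) ≤ D := by omega
  have h1 : wt a S ≤ ∑ a ∈ L, wt a S := single_le_sum (fun b _ => wt_nonneg b S) ha
  have h2 : (1 / 2 : ℝ) ^ D ≤ wt a S := by
    simp only [wt, if_pos hD]
    exact pow_le_pow_of_le_one (by norm_num) (by norm_num) hD
  have h3 : (1 : ℝ) ≤ (#L * (1 - R / (4 * #L)) ^ M) * 2 ^ D := by
    have h4 := (h2.trans h1).trans hS
    calc (1 : ℝ) = (1 / 2) ^ D * 2 ^ D := by rw [← mul_pow]; norm_num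
      _ ≤ _ := mul_le_mul_of_nonneg_right h4 (by positivity)
  linarith

section BezoutBound

open MvPolynomial

variable {K : Type*} [Field K]

lemma finrank_restrictTotalDegree_fin_three (m : ℕ) :
    Module.finrank K (restrictTotalDegree (Fin 3) K m) = (m + 3).choose 3 := by
  classical
  let s : Finset (Fin 3 →₀ ℕ) := (range (m + 1)).biUnion fun n => univ.finsuppAntidiag n
  have hs : (s : Set (Fin 3 →₀ ℕ)) = { n | (n.sum fun _ e => e) ≤ m } := by
    ext n
    simp [s, mem_finsuppAntidiag, Finsupp.sum_fintype]
  have hcard : #s = (m + 3).choose 3 := by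
    rw [card_biUnion]
    · have h1 : ∀ n ∈ range (m + 1), #((univ : Finset (Fin 3)).finsuppAntidiag n) =
          (n + 2).choose 2 := by
        intro n _
        rw [card_finsuppAntidiag_nat_eq_choose, card_univ, Fintype.card_fin,
          show 3 + n - 1 = n + 2 by omega, ← Nat.choose_symm (by omega : n ≤ n + 2)]
        congr 1
        omega
      rw [sum_congr rfl h1]
      clear h1 hs
      induction m with
      | zero => rfl
      | succ m ih =>
        rw [sum_range_succ, ih, show m + 1 + 3 = (m + 3) + 1 by ring,
          Nat.choose_succ_succ' (m + 3) 2,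
          show m + 1 + 2 = m + 3 by ring]
        ring
    · intro a _ b _ hab
      rw [Function.onFun, disjoint_left]
      intro n hn hn'
      rw [mem_finsuppAntidiag] at hn hn'
      exact hab (hn.1.symm.trans hn'.1)
  rw [restrictTotalDegree, ← hs]
  refine (Module.finrank_eq_card_basis (basisRestrictSupport K (s : Set (Fin 3 →₀ ℕ)))).trans ?_
  simpa using hcard

lemma choose_three_second_difference (d e m : ℕ) (hm : d + e ≤ m) :
    (m + 3).choose 3 + (m - d - e + 3).choose 3 ≤
      (m - d + 3).choose 3 + (m - e + 3).choose 3 + d * e * (m + 2) := by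
  obtain ⟨r, rfl⟩ := Nat.exists_eq_add_of_le hm
  have h6 : ∀ x : ℕ, 6 * (x + 3).choose 3 = (x + 1) * (x + 2) * (x + 3) := by
    intro x
    induction x with
    | zero => rfl
    | succ x ih =>
      have h2 : 2 * (x + 3).choose 2 = (x + 3) * (x + 2) := by
        rw [Nat.choose_two_right, Nat.mul_div_cancel' (Nat.even_mul_pred_self (x + 3)).two_dvd]
        rfl
      rw [show x + 1 + 3 = (x + 3) + 1 by ring, Nat.choose_succ_succ' (x + 3) 2]
      linarith [h2, ih]
  have e1 : d + e + r - d - e = r := by omega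
  have e2 : d + e + r - d = e + r := by omega
  have e3 : d + e + r - e = d + r := by omega
  rw [e1, e2, e3]
  have a1 := h6 (d + e + r)
  have a2 := h6 r
  have a3 := h6 (e + r)
  have a4 := h6 (d + r)
  have h : (d + e + r + 1) * (d + e + r + 2) * (d + e + r + 3) + (r + 1) * (r + 2) * (r + 3) ≤
      (e + r + 1) * (e + r + 2) * (e + r + 3) + (d + r + 1) * (d + r + 2) * (d + r + 3) +
        6 * (d * e * (d + e + r + 2)) := by
    have : 0 ≤ 3 * (d * e * (d + e)) := by positivity
    nlinarith
  linarith

/-- Two coprime trivariate polynomials of degrees `d` and `e` cut out a scheme whose Hilbert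
function grows at most like `d * e * m`. -/
theorem card_le_of_linearIndependent_of_kills {F G : MvPolynomial (Fin 3) K} (hF : Irreducible F)
    (hFG : ¬ F ∣ G) {V : Type*} [AddCommGroup V] [Module K V]
    (φ : MvPolynomial (Fin 3) K →ₗ[K] V) (hφF : ∀ H, φ (F * H) = 0) (hφG : ∀ H, φ (G * H) = 0)
    {m : ℕ} (hm : F.totalDegree + G.totalDegree ≤ m) {ι : Type*} [Fintype ι]
    (v : ι → MvPolynomial (Fin 3) K) (hv : ∀ i, (v i).totalDegree ≤ m)
    (hli : LinearIndependent K fun i => φ (v i)) :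
    Fintype.card ι ≤ F.totalDegree * G.totalDegree * (m + 2) := by
  have hF0 : F ≠ 0 := hF.ne_zero
  have hG0 : G ≠ 0 := fun h => hFG (h ▸ dvd_zero F)
  set d := F.totalDegree
  set e := G.totalDegree
  have mulmem : ∀ P : MvPolynomial (Fin 3) K, P.totalDegree ≤ m →
      ∀ H ∈ restrictTotalDegree (Fin 3) K (m - P.totalDegree),
        LinearMap.mulLeft K P H ∈ restrictTotalDegree (Fin 3) K m := by
    intro P hP H hH
    rw [mem_restrictTotalDegree] at hH ⊢
    have := totalDegree_mul P H
    simp only [LinearMap.mulLeft_apply]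
    omega
  let mF := (LinearMap.mulLeft K F).restrict (mulmem F (by omega))
  let mG := (LinearMap.mulLeft K G).restrict (mulmem G (by omega))
  have hmF : Function.Injective mF := by
    intro a b hab
    have := congrArg Subtype.val hab
    exact Subtype.ext (mul_left_cancel₀ hF0 (by simpa [mF] using this))
  have hmG : Function.Injective mG := by
    intro a b hab
    have := congrArg Subtype.val hab
    exact Subtype.ext (mul_left_cancel₀ hG0 (by simpa [mG] using this))
  have mFGmem : ∀ H ∈ restrictTotalDegree (Fin 3) K (m - d - e),
      LinearMap.mulLeft K (F * G) H ∈ restrictTotalDegree (Fin 3) K m := by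
    intro H hH
    rw [mem_restrictTotalDegree] at hH ⊢
    have h1 := totalDegree_mul (F * G) H
    have h2 := totalDegree_mul F G
    simp only [LinearMap.mulLeft_apply]
    omega
  let mFG := (LinearMap.mulLeft K (F * G)).restrict mFGmem
  have hinf : mF.range ⊓ mG.range ≤ mFG.range := by
    rintro x ⟨⟨a, ha⟩, ⟨b, hb⟩⟩
    have ha' : F * a.1 = x.1 := by simpa [mF] using congrArg Subtype.val ha
    have hb' : G * b.1 = x.1 := by simpa [mG] using congrArg Subtype.val hb
    have hdvd : F ∣ G * b.1 := ⟨a.1, hb'.trans ha'.symm⟩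
    obtain ⟨c, hc⟩ := (hF.prime.dvd_or_dvd hdvd).resolve_left hFG
    have hcdeg : c.totalDegree ≤ m - d - e := by
      rcases eq_or_ne c 0 with rfl | hc0
      · simp
      have h1 := (mem_restrictTotalDegree _ _ _).1 b.2
      rw [hc, totalDegree_mul_of_isDomain hF0 hc0] at h1
      omega
    refine ⟨⟨c, (mem_restrictTotalDegree _ _ _).2 hcdeg⟩, Subtype.ext ?_⟩
    simp only [mFG, LinearMap.coe_restrict_apply, LinearMap.mulLeft_apply]
    rw [← hb', hc]
    ring
  have hsum := Submodule.finrank_sup_add_finrank_inf_eq mF.range mG.range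
  rw [LinearMap.finrank_range_of_inj hmF, LinearMap.finrank_range_of_inj hmG,
    finrank_restrictTotalDegree_fin_three, finrank_restrictTotalDegree_fin_three] at hsum
  change _ + _ = (m - d + 3).choose 3 + (m - e + 3).choose 3 at hsum
  have hinf' : Module.finrank K ↥(mF.range ⊓ mG.range) ≤ (m - d - e + 3).choose 3 := by
    refine (Submodule.finrank_mono hinf).trans ((LinearMap.finrank_range_le _).trans ?_)
    rw [finrank_restrictTotalDegree_fin_three]
  let ψ := φ.domRestrict (restrictTotalDegree (Fin 3) K m)
  have hker : mF.range ⊔ mG.range ≤ ψ.ker := by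
    refine sup_le ?_ ?_
    · rintro _ ⟨a, rfl⟩
      simpa [ψ, mF] using hφF a.1
    · rintro _ ⟨a, rfl⟩
      simpa [ψ, mG] using hφG a.1
  have hrank := LinearMap.finrank_range_add_finrank_ker ψ
  rw [finrank_restrictTotalDegree_fin_three] at hrank
  have hker' := Submodule.finrank_mono hker
  let w : ι → ψ.range := fun i => ⟨φ (v i), ⟨v i, (mem_restrictTotalDegree _ _ _).2 (hv i)⟩, rfl⟩
  have hw : LinearIndependent K w := LinearIndependent.of_comp ψ.range.subtype hli
  have hcard := hw.fintype_card_le_finrank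
  have := choose_three_second_difference d e m hm
  omega

end BezoutBound

section NullLines

open MvPolynomial

variable {K : Type*} [Field K]

/-- The point `P` lies on the null line with parameters `q = (s, v₁, v₂)`, given by the equations
`x + s y = v₁` and `y + s z = v₂`. -/
def OnNullLine (q : K × K × K) (P : Fin 3 → K) : Prop :=
  P 0 + q.1 * P 1 = q.2.1 ∧ P 1 + q.1 * P 2 = q.2.2

/-- Restriction of a trivariate polynomial to the null line with parameters `q`, as a polynomial in
the last coordinate. -/
noncomputable def nullRestrict (q : K × K × K) : MvPolynomial (Fin 3) K →ₐ[K] Polynomial K :=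
  aeval ![Polynomial.C (q.2.1 - q.1 * q.2.2) + Polynomial.C (q.1 ^ 2) * Polynomial.X,
    Polynomial.C q.2.2 - Polynomial.C q.1 * Polynomial.X, Polynomial.X]

lemma nullRestrict_X_zero (q : K × K × K) : nullRestrict q (X 0) =
    Polynomial.C (q.2.1 - q.1 * q.2.2) + Polynomial.C (q.1 ^ 2) * Polynomial.X := by
  simp [nullRestrict]

lemma nullRestrict_X_one (q : K × K × K) : nullRestrict q (X 1) =
    Polynomial.C q.2.2 - Polynomial.C q.1 * Polynomial.X := by
  simp [nullRestrict]

lemma nullRestrict_X_two (q : K × K × K) : nullRestrict q (X 2) = Polynomial.X := by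
  simp [nullRestrict]

lemma nullRestrict_C (q : K × K × K) (a : K) : nullRestrict q (C a) = Polynomial.C a := by
  simp [nullRestrict]

lemma eval_nullRestrict {q : K × K × K} {P : Fin 3 → K} (h : OnNullLine q P)
    (F : MvPolynomial (Fin 3) K) : (nullRestrict q F).eval (P 2) = eval P F := by
  induction F using MvPolynomial.induction_on with
  | C a => simp
  | add f g hf hg => simp [hf, hg]
  | mul_X f i hf =>
    rw [map_mul, Polynomial.eval_mul, hf, map_mul, eval_X]
    congr 1
    obtain ⟨h1, h2⟩ := h
    fin_cases i
    · simp only [Fin.zero_eta, nullRestrict_X_zero]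
      simp only [map_sub, map_mul, map_pow, Polynomial.eval_add, Polynomial.eval_sub,
        Polynomial.eval_C, Polynomial.eval_mul, Polynomial.eval_pow, Polynomial.eval_X]
      linear_combination -h1 + q.1 * h2
    · simp only [Fin.mk_one, nullRestrict_X_one]
      simp only [Polynomial.eval_sub, Polynomial.eval_C, Polynomial.eval_mul, Polynomial.eval_X]
      linear_combination -h2
    · simp [nullRestrict_X_two]

lemma natDegree_nullRestrict_le (q : K × K × K) (F : MvPolynomial (Fin 3) K) :
    (nullRestrict q F).natDegree ≤ F.totalDegree := by
  rw [← mul_one F.totalDegree]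
  refine aeval_natDegree_le F le_rfl _ fun i => ?_
  fin_cases i
  · simp only [Fin.zero_eta, Matrix.cons_val_zero]
    compute_degree
  · simp only [Fin.mk_one, Matrix.cons_val_one, Matrix.cons_val_zero]
    rw [sub_eq_add_neg, ← neg_mul, ← Polynomial.C_neg, add_comm]
    exact Polynomial.natDegree_linear_le
  · simp

/-- A null line different from `q` lies in a plane not containing `q`. -/
lemma exists_separating_linear {q q' : K × K × K} (hq : q ≠ q') :
    ∃ l : MvPolynomial (Fin 3) K, l.totalDegree ≤ 1 ∧ nullRestrict q' l = 0 ∧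
      nullRestrict q l ≠ 0 := by
  have hdeg : ∀ (i j : Fin 3) (a b : K),
      (X i + C a * X j - C b : MvPolynomial (Fin 3) K).totalDegree ≤ 1 := by
    intro i j a b
    refine (totalDegree_sub _ _).trans (max_le ((totalDegree_add _ _).trans (max_le ?_ ?_)) ?_)
    · simp
    · refine (totalDegree_mul _ _).trans ?_
      simp
    · simp
  by_contra! H
  have h1 := H (X 0 + C q'.1 * X 1 - C q'.2.1) (hdeg _ _ _ _) (by
    simp only [map_add, map_sub, map_mul, nullRestrict_X_zero, nullRestrict_X_one, nullRestrict_C,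
      map_pow]
    ring)
  have h2 := H (X 1 + C q'.1 * X 2 - C q'.2.2) (hdeg _ _ _ _) (by
    simp only [map_add, map_sub, map_mul, nullRestrict_X_two, nullRestrict_X_one, nullRestrict_C]
    ring)
  simp only [map_add, map_sub, map_mul, nullRestrict_X_zero, nullRestrict_X_one, nullRestrict_C,
      nullRestrict_X_two] at h1 h2
  have e1 := congrArg (Polynomial.coeff · 0) h2
  have e2 := congrArg (Polynomial.coeff · 1) h2
  have e3 := congrArg (Polynomial.coeff · 0) h1
  simp [Polynomial.coeff_X, Polynomial.coeff_C] at e1 e2 e3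
  apply hq
  obtain ⟨s, v1, v2⟩ := q
  obtain ⟨s', v1', v2'⟩ := q'
  simp only [Prod.mk.injEq] at *
  have hs : s = s' := by linear_combination -e2
  subst hs
  have hv2 : v2 = v2' := by linear_combination e1
  subst hv2
  exact ⟨rfl, by linear_combination e3, rfl⟩

/-- Two coprime surfaces of degrees `d` and `e` have at most `d * e` null lines in common. -/
theorem card_le_of_nullRestrict_eq_zero {F G : MvPolynomial (Fin 3) K} (hF : Irreducible F)
    (hFG : ¬ F ∣ G) (L : Finset (K × K × K)) (hLF : ∀ q ∈ L, nullRestrict q F = 0)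
    (hLG : ∀ q ∈ L, nullRestrict q G = 0) : #L ≤ F.totalDegree * G.totalDegree := by
  classical
  by_contra! hlt
  set d := F.totalDegree with hd
  set e := G.totalDegree with he
  set n := #L with hn
  set h := d * e * (n + 2) + 1 + d + e with hh
  choose! l hl1 hl2 hl3 using fun (q q' : K × K × K) (hq : q ≠ q') => exists_separating_linear hq
  let R : K × K × K → MvPolynomial (Fin 3) K := fun q => ∏ q' ∈ L.erase q, l q q'
  let v : L × Fin h → MvPolynomial (Fin 3) K := fun i => R i.1 * X 2 ^ (i.2 : ℕ)
  let φ : MvPolynomial (Fin 3) K →ₗ[K] (L → Polynomial K) :=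
    LinearMap.pi fun q => (nullRestrict q.1).toLinearMap
  have hR : ∀ q ∈ L, nullRestrict q (R q) ≠ 0 := by
    intro q _
    rw [map_prod, prod_ne_zero_iff]
    exact fun q' hq' => hl3 q q' (ne_of_mem_erase hq').symm
  have hR0 : ∀ q ∈ L, ∀ q' ∈ L, q' ≠ q → nullRestrict q' (R q) = 0 := by
    intro q _ q' hq' hne
    rw [map_prod]
    exact prod_eq_zero (mem_erase.2 ⟨hne, hq'⟩) (hl2 q q' hne.symm)
  have hdegR : ∀ q ∈ L, (R q).totalDegree ≤ n := by
    intro q _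
    refine (totalDegree_finsetProd _ _).trans ?_
    refine (sum_le_card_nsmul _ _ 1 fun q' hq' => hl1 q q' (ne_of_mem_erase hq').symm).trans ?_
    simpa using card_erase_le
  have hv : ∀ i, (v i).totalDegree ≤ n + h := by
    intro i
    refine (totalDegree_mul _ _).trans (add_le_add (hdegR _ i.1.2) ?_)
    rw [totalDegree_X_pow]
    exact i.2.2.le
  have hli : LinearIndependent K fun i => φ (v i) := by
    rw [Fintype.linearIndependent_iff]
    intro c hc
    have hq : ∀ q : L, ∑ j : Fin h, Polynomial.C (c (q, j)) * Polynomial.X ^ (j : ℕ) = 0 := by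
      intro q
      have h1 := congrFun hc q
      rw [Fintype.sum_prod_type, Finset.sum_apply, sum_eq_single q] at h1
      · refine (mul_eq_zero.1 ?_).resolve_left (hR q q.2)
        rw [mul_sum]
        simp only [Finset.sum_apply, Pi.smul_apply, Pi.zero_apply, φ, v, LinearMap.pi_apply,
          AlgHom.toLinearMap_apply, map_mul, map_pow, nullRestrict_X_two] at h1
        rw [← h1]
        refine sum_congr rfl fun j _ => ?_
        rw [Polynomial.smul_eq_C_mul]
        ring
      · intro q' _ hne
        rw [Finset.sum_apply]
        refine sum_eq_zero fun j _ => ?_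
        have := hR0 q' q'.2 q q.2 (fun h => hne (Subtype.ext h.symm))
        simp [φ, v, this]
      · simp
    rintro ⟨q, j⟩
    have h2 := congrArg (Polynomial.coeff · (j : ℕ)) (hq q)
    simp only [Polynomial.finsetSum_coeff, Polynomial.coeff_C_mul, Polynomial.coeff_X_pow,
      Polynomial.coeff_zero] at h2
    rw [sum_eq_single j] at h2
    · simpa using h2
    · intro b _ hb
      rw [if_neg (fun h => hb (Fin.ext h.symm)), mul_zero]
    · simp
  have hcard := card_le_of_linearIndependent_of_kills hF hFG φ
    (fun H => by ext q; simp [φ, hLF q.1 q.2]) (fun H => by ext q; simp [φ, hLG q.1 q.2])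
    (m := n + h) (by omega) v hv hli
  rw [Fintype.card_prod, Fintype.card_coe, Fintype.card_fin, ← hn, ← hd, ← he] at hcard
  have h3 : (d * e + 1) * h ≤ n * h := Nat.mul_le_mul_right _ hlt
  nlinarith

end NullLines

section FormalCurves

open MvPolynomial

variable {K : Type*} [Field K]

lemma derivative_aeval_eq_sum {R : Type*} [CommRing R] [Algebra K R] (g : Fin 3 → Polynomial R)
    (F : MvPolynomial (Fin 3) K) :
    Polynomial.derivative (aeval g F) =
      ∑ i, aeval g (pderiv i F) * Polynomial.derivative (g i) := by
  induction F using MvPolynomial.induction_on with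
  | C a => simp [Polynomial.algebraMap_apply]
  | add f h hf hh => simp only [map_add, hf, hh, add_mul, sum_add_distrib]
  | mul_X f i hf =>
    rw [map_mul, Polynomial.derivative_mul, hf, aeval_X]
    have h1 : ∀ j, aeval g (pderiv j (f * X i)) * Polynomial.derivative (g j) =
        aeval g (pderiv j f) * Polynomial.derivative (g j) * g i +
          if j = i then aeval g f * Polynomial.derivative (g j) else 0 := by
      intro j
      rw [pderiv_mul, map_add, map_mul, map_mul, aeval_X]
      split_ifs with h
      · subst h
        simp
        ring
      · rw [pderiv_X_of_ne (fun hh => h hh.symm)]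
        simp
        ring
    simp only [h1, sum_add_distrib, sum_ite_eq', mem_univ, if_true, sum_mul]

/-- A polynomial solution of `a f'' = Q f' + R f` with `a(0) ≠ 0` and vanishing initial data is
zero, provided the characteristic exceeds its degree. -/
lemma eq_zero_of_second_order_ode {R : Type*} [CommRing R] [IsDomain R] {f a b c : Polynomial R}
    (hf : a * Polynomial.derivative (Polynomial.derivative f) =
      b * Polynomial.derivative f + c * f) (ha : a.coeff 0 ≠ 0)
    (h0 : f.coeff 0 = 0) (h1 : f.coeff 1 = 0)
    (hchar : ∀ n : ℕ, 0 < n → n ≤ f.natDegree → (n : R) ≠ 0) : f = 0 := by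
  by_contra hne
  obtain ⟨g, hg, hndvd⟩ := Polynomial.exists_eq_pow_rootMultiplicity_mul_and_not_dvd f hne 0
  rw [Polynomial.C_0, sub_zero] at hg hndvd
  have hg0 : g.coeff 0 ≠ 0 := fun h => hndvd (Polynomial.X_dvd_iff.2 h)
  set r := Polynomial.rootMultiplicity 0 f with hr
  have hr2 : 2 ≤ r := by
    by_contra! hlt
    interval_cases h : r
    · rw [hg] at h0
      simp at h0
      exact hg0 h0
    · rw [hg, pow_one, Polynomial.coeff_X_mul] at h1
      exact hg0 h1
  have hrdeg : r ≤ f.natDegree := by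
    rw [hg, Polynomial.natDegree_mul (by simp) (fun h => hg0 (by simp [h])),
      Polynomial.natDegree_X_pow]
    omega
  obtain ⟨s, hs⟩ := Nat.exists_eq_add_of_le' hr2
  rw [hs] at hg hrdeg
  have hd1 : Polynomial.derivative f = Polynomial.X ^ (s + 1) *
      (((s + 2 : ℕ) : Polynomial R) * g + Polynomial.X * Polynomial.derivative g) := by
    rw [hg, Polynomial.derivative_mul, Polynomial.derivative_X_pow]
    simp only [map_natCast, Nat.add_succ_sub_one]
    ring
  have hd2 : Polynomial.derivative (Polynomial.derivative f) = Polynomial.X ^ s *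
      (((s + 2 : ℕ) : Polynomial R) * ((s + 1 : ℕ) : Polynomial R) * g +
        Polynomial.X * (((2 * s + 4 : ℕ) : Polynomial R) * Polynomial.derivative g +
        Polynomial.X * Polynomial.derivative (Polynomial.derivative g))) := by
    rw [hd1, Polynomial.derivative_mul, Polynomial.derivative_X_pow]
    simp only [map_natCast, Nat.add_succ_sub_one, Polynomial.derivative_add,
      Polynomial.derivative_mul, Polynomial.derivative_natCast, Polynomial.derivative_X]
    push_cast
    ring
  have heq : Polynomial.X ^ s *
      (a * (((s + 2 : ℕ) : Polynomial R) * ((s + 1 : ℕ) : Polynomial R) * g + Polynomial.X *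
      (((2 * s + 4 : ℕ) : Polynomial R) * Polynomial.derivative g +
        Polynomial.X * Polynomial.derivative (Polynomial.derivative g)))) =
      Polynomial.X ^ s * (Polynomial.X * (b * (((s + 2 : ℕ) : Polynomial R) * g +
        Polynomial.X * Polynomial.derivative g) + c * Polynomial.X * g)) := by
    have := hf
    rw [hd2, hd1] at this
    linear_combination this + c * hg
  have h3 := mul_left_cancel₀ (pow_ne_zero _ Polynomial.X_ne_zero) heq
  have h4 := congrArg (Polynomial.eval 0) h3
  simp only [Polynomial.eval_mul, Polynomial.eval_add, Polynomial.eval_X, zero_mul, add_zero,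
    Polynomial.eval_natCast, ← Polynomial.coeff_zero_eq_eval_zero] at h4
  refine mul_ne_zero ha (mul_ne_zero (mul_ne_zero ?_ ?_) hg0) h4
  · exact hchar _ (by omega) hrdeg
  · exact hchar _ (by omega) (by omega)

/-- `w + a τ` and `c τ` are algebraically independent over `K` in `K[w][τ]` when `c ≠ 0`. -/
lemma eq_zero_of_sum_pow_mul_pow_eq_zero {a c : Polynomial K} (hc : c ≠ 0) {h : ℕ}
    (u : Fin h → Fin h → K)
    (hu : ∑ i, ∑ j, Polynomial.C (Polynomial.C (u i j)) *
      (Polynomial.C Polynomial.X + Polynomial.X * Polynomial.C a) ^ (i : ℕ) *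
        (Polynomial.X * Polynomial.C c) ^ (j : ℕ) = 0) (i j : Fin h) : u i j = 0 := by
  set Z : Polynomial (Polynomial K) := Polynomial.C Polynomial.X + Polynomial.X * Polynomial.C a
    with hZ
  let ψ : Polynomial K →+* Polynomial (Polynomial K) := (Polynomial.aeval Z).toRingHom
  let Ψ : Polynomial (Polynomial K) →+* Polynomial (Polynomial K) :=
    Polynomial.eval₂RingHom ψ (Polynomial.X * Polynomial.C c)
  have hΨ0 : (Polynomial.evalRingHom 0).comp Ψ = Polynomial.evalRingHom 0 := by
    refine Polynomial.ringHom_ext' (Polynomial.ringHom_ext ?_ ?_) ?_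
    · intro b
      simp [Ψ, ψ, Polynomial.algebraMap_apply]
    · simp [Ψ, ψ, hZ]
    · simp [Ψ]
  have hinj : ∀ f, Ψ f = 0 → f = 0 := by
    intro f hf
    by_contra hne
    obtain ⟨g, hg, hndvd⟩ := Polynomial.exists_eq_pow_rootMultiplicity_mul_and_not_dvd f hne 0
    rw [Polynomial.C_0, sub_zero] at hg hndvd
    have hX : Ψ Polynomial.X ≠ 0 := by simp [Ψ, hc]
    rw [hg, map_mul, map_pow] at hf
    have hg0 := (mul_eq_zero.1 hf).resolve_left (pow_ne_zero _ hX)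
    have h1 := congrArg (Polynomial.evalRingHom 0) hg0
    rw [← RingHom.comp_apply, hΨ0, map_zero] at h1
    exact hndvd (Polynomial.X_dvd_iff.2 (by simpa [Polynomial.coeff_zero_eq_eval_zero] using h1))
  have hf := hinj (∑ i : Fin h, ∑ j : Fin h, Polynomial.C (Polynomial.C (u i j)) *
      (Polynomial.C Polynomial.X) ^ (i : ℕ) * Polynomial.X ^ (j : ℕ)) (by
    rw [← hu]
    simp only [map_sum, map_mul, map_pow]
    simp [Ψ, ψ, Polynomial.algebraMap_apply])
  have h2 := congrArg (fun f => (Polynomial.coeff (Polynomial.coeff f (j : ℕ)) (i : ℕ))) hf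
  simp only [Polynomial.finsetSum_coeff, ← Polynomial.C_pow, ← Polynomial.C_mul,
    Polynomial.coeff_C_mul, Polynomial.coeff_X_pow, Polynomial.coeff_zero] at h2
  rw [sum_eq_single i, sum_eq_single j] at h2
  · simpa using h2
  · intro b _ hb
    rw [if_neg (fun h => hb (Fin.ext h.symm))]
    simp
  · simp
  · intro b _ hb
    refine sum_eq_zero fun b' _ => ?_
    split_ifs
    · simp only [mul_one, Polynomial.coeff_C_mul, Polynomial.coeff_X_pow]
      rw [if_neg (fun h => hb (Fin.ext h.symm)), mul_zero]
    · simp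
  · simp

/-- A two-dimensional formal family of points lies on at most one irreducible surface. -/
theorem dvd_of_aeval_eq_zero {F G N : MvPolynomial (Fin 3) K} (hF : Irreducible F)
    (θ : MvPolynomial (Fin 3) K →ₐ[K] Polynomial (Polynomial K)) (hθF : θ F = 0) (hθG : θ G = 0)
    {a c : Polynomial K} (hc : c ≠ 0)
    (hz : θ (X 2) = Polynomial.C Polynomial.X + Polynomial.X * Polynomial.C a)
    (hN : θ N = Polynomial.X * Polynomial.C c) (hNdeg : N.totalDegree ≤ 1) : F ∣ G := by
  by_contra hFG
  set d := F.totalDegree with hd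
  set e := G.totalDegree with he
  set h := 2 * (d * e) + 2 * (d * e) + d + e + 1 with hh
  let v : Fin h × Fin h → MvPolynomial (Fin 3) K := fun i => X 2 ^ (i.1 : ℕ) * N ^ (i.2 : ℕ)
  have hv : ∀ i, (v i).totalDegree ≤ 2 * h := by
    intro i
    refine (totalDegree_mul _ _).trans ?_
    rw [totalDegree_X_pow]
    have h1 := totalDegree_pow N i.2
    have h2 := i.1.2
    have h3 := i.2.2
    nlinarith
  have hli : LinearIndependent K fun i => θ.toLinearMap (v i) := by
    rw [Fintype.linearIndependent_iff]
    rintro u hu ⟨i, j⟩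
    refine eq_zero_of_sum_pow_mul_pow_eq_zero (a := a) hc (fun i j => u (i, j)) ?_ i j
    rw [Fintype.sum_prod_type] at hu
    rw [← hu]
    refine sum_congr rfl fun i _ => sum_congr rfl fun j _ => ?_
    simp only [AlgHom.toLinearMap_apply, v, map_mul, map_pow, hz, hN, Algebra.smul_def,
      Polynomial.algebraMap_apply, Algebra.algebraMap_self, RingHom.id_apply]
    ring
  have hcard := card_le_of_linearIndependent_of_kills hF hFG θ.toLinearMap
    (fun H => by simp [hθF]) (fun H => by simp [hθG]) (m := 2 * h) (by omega) v hv hli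
  rw [Fintype.card_prod, Fintype.card_fin, ← hd, ← he] at hcard
  nlinarith

end FormalCurves

section NullSurfaces

open MvPolynomial

variable {K : Type*} [Field K]

lemma pderiv_comm_of_fin (i j : Fin 3) (F : MvPolynomial (Fin 3) K) :
    pderiv i (pderiv j F) = pderiv j (pderiv i F) := by
  rcases eq_or_ne i j with rfl | hij
  · rfl
  ext m
  rw [coeff_pderiv, coeff_pderiv, coeff_pderiv, coeff_pderiv, add_right_comm]
  simp only [Finsupp.add_apply, Finsupp.single_eq_of_ne hij, Finsupp.single_eq_of_ne hij.symm,
    add_zero]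
  ring

lemma totalDegree_pderiv_le_sub_one (i : Fin 3) (F : MvPolynomial (Fin 3) K) :
    (pderiv i F).totalDegree ≤ F.totalDegree - 1 := by
  refine Finset.sup_le fun m hm => ?_
  have h1 : m + Finsupp.single i 1 ∈ F.support := by
    rw [mem_support_iff, coeff_pderiv] at hm
    exact mem_support_iff.2 (left_ne_zero_of_mul hm)
  have h2 := le_totalDegree h1
  rw [Finsupp.sum_add_index' (fun _ => rfl) (fun _ _ _ => rfl), Finsupp.sum_single_index rfl] at h2
  omega

lemma exists_eq_C_of_pderiv_eq_zero {F : MvPolynomial (Fin 3) K}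
    (hchar : ∀ n : ℕ, 0 < n → n ≤ F.totalDegree → (n : K) ≠ 0) (h : ∀ i, pderiv i F = 0) :
    ∃ a, F = C a := by
  refine ⟨coeff 0 F, totalDegree_eq_zero_iff_eq_C.1 ?_⟩
  rw [← Nat.le_zero]
  refine Finset.sup_le fun m hm => ?_
  by_contra hne
  have hm0 : m ≠ 0 := by
    rintro rfl
    simp at hne
  obtain ⟨i, hi⟩ := Finsupp.ne_iff.1 hm0
  rw [Finsupp.zero_apply] at hi
  have hle : Finsupp.single i 1 ≤ m := by
    rw [Finsupp.single_le_iff]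
    omega
  have h1 := congrArg (coeff (m - Finsupp.single i 1)) (h i)
  rw [coeff_pderiv, tsub_add_cancel_of_le hle, coeff_zero] at h1
  have h2 : (((m - Finsupp.single i 1 : Fin 3 →₀ ℕ) i : ℕ) : K) + 1 = (m i : ℕ) := by
    rw [Finsupp.tsub_apply, Finsupp.single_eq_same, ← Nat.cast_add_one,
      Nat.sub_add_cancel (by omega)]
  rw [h2] at h1
  have h3 : m i ≤ F.totalDegree := by
    refine le_trans ?_ (le_totalDegree hm)
    rw [Finsupp.sum_fintype _ _ (fun _ => rfl)]
    exact single_le_sum (f := fun i => m i) (fun _ _ => Nat.zero_le _) (mem_univ i)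
  exact mul_ne_zero (mem_support_iff.1 hm) (hchar _ (by omega) h3) h1

lemma derivative_nullRestrict (q : K × K × K) (F : MvPolynomial (Fin 3) K) :
    Polynomial.derivative (nullRestrict q F) =
      nullRestrict q (C (q.1 ^ 2) * pderiv 0 F - C q.1 * pderiv 1 F + pderiv 2 F) := by
  rw [map_add (nullRestrict q), map_sub (nullRestrict q), map_mul (nullRestrict q),
    map_mul (nullRestrict q), nullRestrict_C, nullRestrict_C]
  refine (derivative_aeval_eq_sum _ F).trans ?_
  rw [Fin.sum_univ_three]
  change nullRestrict q (pderiv 0 F) * Polynomial.derivative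
      (Polynomial.C (q.2.1 - q.1 * q.2.2) + Polynomial.C (q.1 ^ 2) * Polynomial.X) +
    nullRestrict q (pderiv 1 F) *
      Polynomial.derivative (Polynomial.C q.2.2 - Polynomial.C q.1 * Polynomial.X) +
    nullRestrict q (pderiv 2 F) * Polynomial.derivative Polynomial.X = _
  simp only [Polynomial.derivative_add, Polynomial.derivative_sub, Polynomial.derivative_C,
    Polynomial.derivative_C_mul, Polynomial.derivative_X]
  ring

/-- The quadratic form `α s² - β s + γ` in the direction `s` attached to the gradient. -/
lemma gradient_of_onNullLine {F : MvPolynomial (Fin 3) K} {q : K × K × K} {P : Fin 3 → K}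
    (hP : OnNullLine q P) (hF : nullRestrict q F = 0) :
    eval P (pderiv 0 F) * q.1 ^ 2 - eval P (pderiv 1 F) * q.1 + eval P (pderiv 2 F) = 0 := by
  have h := eval_nullRestrict hP (C (q.1 ^ 2) * pderiv 0 F - C q.1 * pderiv 1 F + pderiv 2 F)
  rw [← derivative_nullRestrict, hF] at h
  simp only [map_zero, Polynomial.eval_zero, map_add, map_sub, map_mul, eval_C] at h
  linear_combination -h

lemma hessian_of_onNullLine {F : MvPolynomial (Fin 3) K} {q : K × K × K} {P : Fin 3 → K}
    (hP : OnNullLine q P) (hF : nullRestrict q F = 0) :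
    eval P (pderiv 0 (pderiv 0 F)) * q.1 ^ 4 - 2 * eval P (pderiv 0 (pderiv 1 F)) * q.1 ^ 3 +
      (eval P (pderiv 1 (pderiv 1 F)) + 2 * eval P (pderiv 0 (pderiv 2 F))) * q.1 ^ 2 -
        2 * eval P (pderiv 1 (pderiv 2 F)) * q.1 + eval P (pderiv 2 (pderiv 2 F)) = 0 := by
  have h1 : nullRestrict q (C (q.1 ^ 2) * pderiv 0 F - C q.1 * pderiv 1 F + pderiv 2 F) = 0 := by
    rw [← derivative_nullRestrict, hF, Polynomial.derivative_zero]
  have h := gradient_of_onNullLine hP h1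
  simp only [map_add, map_sub, pderiv_C_mul, map_mul, eval_C] at h
  rw [pderiv_comm_of_fin 1 0, pderiv_comm_of_fin 2 0, pderiv_comm_of_fin 2 1] at h
  linear_combination h

lemma onNullLine_ext {q q' : K × K × K} {P : Fin 3 → K} (h : OnNullLine q P)
    (h' : OnNullLine q' P) (hs : q.1 = q'.1) : q = q' := by
  obtain ⟨s, v1, v2⟩ := q
  obtain ⟨s', v1', v2'⟩ := q'
  obtain ⟨h1, h2⟩ := h
  obtain ⟨h1', h2'⟩ := h'
  simp only at *
  subst hs
  rw [← h1, ← h2, ← h1', ← h2']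

end NullSurfaces

section RuledSurfaces

open MvPolynomial

variable {K : Type*} [Field K]

/-- Linear coefficient of the remainder of the Hessian form modulo the gradient form, in the slope
variable. -/
noncomputable def slopeRemainderOne (F : MvPolynomial (Fin 3) K) : MvPolynomial (Fin 3) K :=
  pderiv 0 (pderiv 0 F) * (pderiv 1 F ^ 3 - 2 * pderiv 0 F * pderiv 1 F * pderiv 2 F) -
    2 * pderiv 0 (pderiv 1 F) * pderiv 0 F * (pderiv 1 F ^ 2 - pderiv 0 F * pderiv 2 F) +
    (pderiv 1 (pderiv 1 F) + 2 * pderiv 0 (pderiv 2 F)) * pderiv 0 F ^ 2 * pderiv 1 F -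
    2 * pderiv 1 (pderiv 2 F) * pderiv 0 F ^ 3

/-- Constant coefficient of the remainder of the Hessian form modulo the gradient form, in the
slope variable. -/
noncomputable def slopeRemainderZero (F : MvPolynomial (Fin 3) K) : MvPolynomial (Fin 3) K :=
  -(pderiv 0 (pderiv 0 F) * (pderiv 1 F ^ 2 - pderiv 0 F * pderiv 2 F) * pderiv 2 F) +
    2 * pderiv 0 (pderiv 1 F) * pderiv 0 F * pderiv 1 F * pderiv 2 F -
    (pderiv 1 (pderiv 1 F) + 2 * pderiv 0 (pderiv 2 F)) * pderiv 0 F ^ 2 * pderiv 2 F +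
    pderiv 2 (pderiv 2 F) * pderiv 0 F ^ 3

/-- The two linear forms cutting out a null line. -/
noncomputable def nullLinearOne (q : K × K × K) : MvPolynomial (Fin 3) K :=
  C q.2.1 - X 0 - C q.1 * X 1

/-- The two linear forms cutting out a null line. -/
noncomputable def nullLinearTwo (q : K × K × K) : MvPolynomial (Fin 3) K :=
  C q.2.2 - X 1 - C q.1 * X 2

/-- The gradient form evaluated at the direction pointing to the null line `q`. -/
noncomputable def nullForm (F : MvPolynomial (Fin 3) K) (q : K × K × K) :
    MvPolynomial (Fin 3) K :=
  pderiv 0 F * nullLinearOne q ^ 2 + pderiv 1 F * nullLinearOne q * nullLinearTwo q +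
    pderiv 2 F * nullLinearTwo q ^ 2

lemma natDegree_aeval_le_totalDegree {R : Type*} [CommRing R] [Algebra K R]
    {g : Fin 3 → Polynomial R} (hg : ∀ i, (g i).natDegree ≤ 1) (F : MvPolynomial (Fin 3) K) :
    (aeval g F).natDegree ≤ F.totalDegree := by
  have h1 : (map (algebraMap K R) F).totalDegree ≤ F.totalDegree :=
    Finset.sup_mono (support_map_subset _ _)
  have h2 := aeval_natDegree_le (map (algebraMap K R) F) h1 g hg
  rwa [aeval_map_algebraMap, mul_one] at h2

/-- The substitution moving each point of the null line `q` along the direction `(b², a b, a²)`. -/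
noncomputable def tangentSweep (q : K × K × K) (a b : Polynomial K) :
    MvPolynomial (Fin 3) K →ₐ[K] Polynomial (Polynomial K) :=
  aeval ![Polynomial.C (nullRestrict q (X 0)) + Polynomial.X * Polynomial.C (b ^ 2),
    Polynomial.C (nullRestrict q (X 1)) + Polynomial.X * Polynomial.C (a * b),
    Polynomial.C Polynomial.X + Polynomial.X * Polynomial.C (a ^ 2)]

section TangentSweep

variable (q : K × K × K) (a b : Polynomial K)

lemma tangentSweep_X_zero : tangentSweep q a b (X 0) =
    Polynomial.C (nullRestrict q (X 0)) + Polynomial.X * Polynomial.C (b ^ 2) := by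
  simp [tangentSweep]

lemma tangentSweep_X_one : tangentSweep q a b (X 1) =
    Polynomial.C (nullRestrict q (X 1)) + Polynomial.X * Polynomial.C (a * b) := by
  simp [tangentSweep]

lemma tangentSweep_X_two : tangentSweep q a b (X 2) =
    Polynomial.C Polynomial.X + Polynomial.X * Polynomial.C (a ^ 2) := by
  simp [tangentSweep]

lemma tangentSweep_C (c : K) : tangentSweep q a b (C c) = Polynomial.C (Polynomial.C c) := by
  simp [tangentSweep, Polynomial.algebraMap_apply]

lemma coeff_zero_tangentSweep (F : MvPolynomial (Fin 3) K) :
    (tangentSweep q a b F).coeff 0 = nullRestrict q F := by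
  induction F using MvPolynomial.induction_on with
  | C c => simp
  | add f g hf hg => simp [hf, hg]
  | mul_X f i hf =>
    rw [map_mul, Polynomial.mul_coeff_zero, hf, map_mul]
    congr 1
    fin_cases i
    · simp [tangentSweep_X_zero]
    · simp [tangentSweep_X_one]
    · simp [tangentSweep_X_two, nullRestrict_X_two]

lemma derivative_tangentSweep (F : MvPolynomial (Fin 3) K) :
    Polynomial.derivative (tangentSweep q a b F) =
      tangentSweep q a b (pderiv 0 F) * Polynomial.C (b ^ 2) +
        tangentSweep q a b (pderiv 1 F) * Polynomial.C (a * b) +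
          tangentSweep q a b (pderiv 2 F) * Polynomial.C (a ^ 2) := by
  refine (derivative_aeval_eq_sum _ F).trans ?_
  rw [Fin.sum_univ_three]
  change tangentSweep q a b (pderiv 0 F) * Polynomial.derivative
      (Polynomial.C (nullRestrict q (X 0)) + Polynomial.X * Polynomial.C (b ^ 2)) +
    tangentSweep q a b (pderiv 1 F) * Polynomial.derivative
      (Polynomial.C (nullRestrict q (X 1)) + Polynomial.X * Polynomial.C (a * b)) +
    tangentSweep q a b (pderiv 2 F) * Polynomial.derivative
      (Polynomial.C Polynomial.X + Polynomial.X * Polynomial.C (a ^ 2)) = _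
  simp only [Polynomial.derivative_add, Polynomial.derivative_C, Polynomial.derivative_mul,
    Polynomial.derivative_X, zero_add, one_mul, mul_zero, add_zero]

lemma natDegree_tangentSweep_le (F : MvPolynomial (Fin 3) K) :
    (tangentSweep q a b F).natDegree ≤ F.totalDegree := by
  have h2 : ∀ c d : Polynomial K,
      (Polynomial.C c + Polynomial.X * Polynomial.C d).natDegree ≤ 1 := by
    intro c d
    rw [add_comm, mul_comm]
    exact Polynomial.natDegree_linear_le
  refine natDegree_aeval_le_totalDegree (K := K) (fun i => ?_) F
  fin_cases i
  · exact h2 _ _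
  · exact h2 _ _
  · exact h2 _ _

lemma tangentSweep_nullLinearOne : tangentSweep q a b (nullLinearOne q) =
    -(Polynomial.X * Polynomial.C (b * (b + Polynomial.C q.1 * a))) := by
  rw [nullLinearOne]
  simp only [map_sub, map_mul, tangentSweep_X_zero, tangentSweep_X_one, tangentSweep_C,
    nullRestrict_X_zero, nullRestrict_X_one, map_add, map_pow]
  ring

lemma tangentSweep_nullLinearTwo : tangentSweep q a b (nullLinearTwo q) =
    Polynomial.X * Polynomial.C (-(a * (b + Polynomial.C q.1 * a))) := by
  rw [nullLinearTwo]
  simp only [map_sub, map_mul, map_neg, tangentSweep_X_two, tangentSweep_X_one, tangentSweep_C,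
    nullRestrict_X_one, map_add, map_pow]
  ring

end TangentSweep

lemma totalDegree_nullLinearTwo_le (q : K × K × K) : (nullLinearTwo q).totalDegree ≤ 1 := by
  refine (totalDegree_sub _ _).trans (max_le ((totalDegree_sub _ _).trans (max_le ?_ ?_)) ?_)
  · simp
  · simp
  · refine (totalDegree_mul _ _).trans ?_
    simp

/-- If the second-order condition for null directions holds identically on the surface `F = 0`, and
`q` is a null line on the surface along which the two null directions are distinct, then all null
lines in the other direction through points of `q` lie on the surface; consequently the surface
satisfies the first-order equation `nullForm F q = 0`. -/
theorem dvd_nullForm {F : MvPolynomial (Fin 3) K} (hF : Irreducible F)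
    (hchar : ∀ n : ℕ, 0 < n → n ≤ F.totalDegree → (n : K) ≠ 0)
    (h1 : F ∣ slopeRemainderOne F) (h0 : F ∣ slopeRemainderZero F) {q : K × K × K}
    (hq : nullRestrict q F = 0) (hx : nullRestrict q (pderiv 0 F) ≠ 0)
    (hdisc : nullRestrict q (pderiv 1 F ^ 2 - 4 * pderiv 0 F * pderiv 2 F) ≠ 0) :
    F ∣ nullForm F q := by
  obtain ⟨w1, hw1⟩ := h1
  obtain ⟨w0, hw0⟩ := h0
  set a := nullRestrict q (pderiv 0 F) with ha
  set b := Polynomial.C q.1 * a - nullRestrict q (pderiv 1 F) with hb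
  have hc : nullRestrict q (pderiv 2 F) = -(Polynomial.C q.1 * b) := by
    have h := derivative_nullRestrict q F
    rw [hq, Polynomial.derivative_zero] at h
    simp only [map_add, map_sub, map_mul, nullRestrict_C, ← ha, Polynomial.C_pow] at h
    rw [hb]
    linear_combination -h
  have hbeta : nullRestrict q (pderiv 1 F) = Polynomial.C q.1 * a - b := by rw [hb]; ring
  have hab : b + Polynomial.C q.1 * a ≠ 0 := by
    intro h
    apply hdisc
    simp only [map_sub, map_mul, map_pow, map_ofNat, hc, hbeta, ← ha]
    linear_combination (b + Polynomial.C q.1 * a) * h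
  set θ := tangentSweep q a b with hθ
  have hderiv : ∀ G, Polynomial.derivative (θ G) = θ (pderiv 0 G) * Polynomial.C (b ^ 2) +
      θ (pderiv 1 G) * Polynomial.C (a * b) + θ (pderiv 2 G) * Polynomial.C (a ^ 2) :=
    derivative_tangentSweep q a b
  have hd1 := hderiv F
  have hode : θ (pderiv 0 F) ^ 3 * Polynomial.derivative (Polynomial.derivative (θ F)) =
      (θ (pderiv 0 F) ^ 2 * θ (pderiv 0 (pderiv 0 F)) * Polynomial.C (b ^ 2) -
        (-2 * θ (pderiv 0 (pderiv 1 F)) * θ (pderiv 0 F) ^ 2 +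
          θ (pderiv 0 (pderiv 0 F)) * θ (pderiv 0 F) * θ (pderiv 1 F)) * Polynomial.C (a * b) +
        ((θ (pderiv 1 (pderiv 1 F)) + 2 * θ (pderiv 0 (pderiv 2 F))) * θ (pderiv 0 F) ^ 2 -
          2 * θ (pderiv 0 (pderiv 1 F)) * θ (pderiv 0 F) * θ (pderiv 1 F) +
          θ (pderiv 0 (pderiv 0 F)) * (θ (pderiv 1 F) ^ 2 - θ (pderiv 0 F) * θ (pderiv 2 F))) *
            Polynomial.C (a ^ 2)) * Polynomial.derivative (θ F) +
      Polynomial.C (a ^ 3) * (-θ w1 * Polynomial.C b + θ w0 * Polynomial.C a) * θ F := by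
    have e1 := congrArg θ hw1
    have e0 := congrArg θ hw0
    simp only [slopeRemainderOne, slopeRemainderZero, map_add, map_sub, map_mul, map_pow, map_neg,
      map_ofNat] at e1 e0
    rw [hd1]
    simp only [Polynomial.derivative_add, Polynomial.derivative_mul, Polynomial.derivative_C,
      mul_zero, add_zero, hderiv]
    rw [pderiv_comm_of_fin 1 0, pderiv_comm_of_fin 2 0, pderiv_comm_of_fin 2 1]
    simp only [map_mul, map_pow]
    linear_combination (-Polynomial.C a ^ 3 * Polynomial.C b) * e1 + (Polynomial.C a ^ 4) * e0
  have hcoeff1 : (θ F).coeff 1 = 0 := by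
    have h := congrArg (Polynomial.coeff · 0) hd1
    simp only [Polynomial.coeff_derivative, Polynomial.coeff_add, Polynomial.coeff_mul_C,
      hθ, coeff_zero_tangentSweep, hc, hbeta, ← ha] at h
    simp only [← hθ, zero_add, Nat.cast_zero, mul_one] at h
    rw [h]
    ring
  have hθF : θ F = 0 := by
    refine eq_zero_of_second_order_ode hode ?_ ?_ hcoeff1 ?_
    · rw [Polynomial.coeff_zero_eq_eval_zero, Polynomial.eval_pow,
        ← Polynomial.coeff_zero_eq_eval_zero, coeff_zero_tangentSweep, ← ha]
      exact pow_ne_zero _ hx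
    · rw [coeff_zero_tangentSweep, hq]
    · intro n hn hn'
      have := hchar n hn (hn'.trans (natDegree_tangentSweep_le q a b F))
      rw [← Polynomial.C_eq_natCast]
      exact Polynomial.C_ne_zero.2 this
  have hθΦ : θ (nullForm F q) = 0 := by
    rw [hθF, Polynomial.derivative_zero] at hd1
    simp only [nullForm, map_add, map_mul, map_pow]
    rw [hθ, tangentSweep_nullLinearOne, tangentSweep_nullLinearTwo, ← hθ]
    simp only [map_mul, map_neg, map_pow, map_add] at hd1 ⊢
    linear_combination (-Polynomial.X ^ 2 * (Polynomial.C b + Polynomial.C (Polynomial.C q.1) *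
      Polynomial.C a) ^ 2) * hd1
  exact dvd_of_aeval_eq_zero hF θ hθF hθΦ (neg_ne_zero.2 (mul_ne_zero hx hab))
    (tangentSweep_X_two q a b) (tangentSweep_nullLinearTwo q a b) (totalDegree_nullLinearTwo_le q)

end RuledSurfaces

section RichStructure

open MvPolynomial

variable {K : Type*} [Field K]

/-- `P` lies on at least two null lines from `L`. -/
def RichPoint (L : Finset (K × K × K)) (P : Fin 3 → K) : Prop :=
  ∃ q ∈ L, ∃ q' ∈ L, q ≠ q' ∧ OnNullLine q P ∧ OnNullLine q' P

/-- The null line `q` lies in the quadric `e (x z - y²) + b x + c y + d z + f = 0`, where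
`t = (e, b, c, d, f)`. -/
def InNullQuadric (t : K × K × K × K × K) (q : K × K × K) : Prop :=
  t.1 * (q.2.1 + q.1 * q.2.2) + t.2.1 * q.1 ^ 2 - t.2.2.1 * q.1 + t.2.2.2.1 = 0 ∧
    -(t.1 * q.2.2 ^ 2) + t.2.1 * (q.2.1 - q.1 * q.2.2) + t.2.2.1 * q.2.2 + t.2.2.2.2 = 0

/-- Coefficients of the quadric swept out by the null lines meeting both `q` and `q'`. -/
def transversalQuadric (q q' : K × K × K) : K × K × K × K × K :=
  (q'.1 - q.1, q.2.2 - q'.2.2, -q.2.1 + q'.2.1 - q.1 * q'.2.2 + q'.1 * q.2.2,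
    -(q.2.1 * q'.1) + q'.2.1 * q.1, q.2.1 * q'.2.2 - q'.2.1 * q.2.2)

lemma transversalQuadric_ne_zero {q q' : K × K × K} (h : q ≠ q') :
    transversalQuadric q q' ≠ 0 := by
  intro h0
  obtain ⟨s, v1, v2⟩ := q
  obtain ⟨s', v1', v2'⟩ := q'
  simp only [transversalQuadric, Prod.mk_eq_zero] at h0
  obtain ⟨h1, h2, h3, -, -⟩ := h0
  have hs : s = s' := by linear_combination -h1
  subst hs
  have hv : v2 = v2' := by linear_combination h2
  subst hv
  have hv1 : v1 = v1' := by linear_combination -h3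
  exact h (by rw [hv1])

lemma inNullQuadric_transversalQuadric {a b q : K × K × K}
    (h : nullRestrict q
      (nullLinearOne a * nullLinearTwo b - nullLinearOne b * nullLinearTwo a) = 0) :
    InNullQuadric (transversalQuadric a b) q := by
  simp only [nullLinearOne, nullLinearTwo, map_sub, map_mul, nullRestrict_C, nullRestrict_X_zero,
    nullRestrict_X_one, nullRestrict_X_two] at h
  set t := transversalQuadric a b with ht
  have h1 : Polynomial.C (t.1 * (q.2.1 + q.1 * q.2.2) + t.2.1 * q.1 ^ 2 - t.2.2.1 * q.1 +
        t.2.2.2.1) * Polynomial.X + Polynomial.C (-(t.1 * q.2.2 ^ 2) + t.2.1 * (q.2.1 - q.1 * q.2.2) +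
        t.2.2.1 * q.2.2 + t.2.2.2.2) = 0 := by
    rw [← h, ht, transversalQuadric]
    simp only [map_add, map_sub, map_mul, map_pow, map_neg]
    ring
  have e0 := congrArg (Polynomial.coeff · 0) h1
  have e1 := congrArg (Polynomial.coeff · 1) h1
  simp only [Polynomial.coeff_add, Polynomial.coeff_C_mul, Polynomial.coeff_X_zero, mul_zero,
    zero_add, Polynomial.coeff_C_zero, Polynomial.coeff_zero] at e0
  simp only [Polynomial.coeff_add, Polynomial.coeff_C_mul, Polynomial.coeff_X_one, mul_one,
    Polynomial.coeff_C_succ, add_zero, Polynomial.coeff_zero] at e1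
  exact ⟨e1, e0⟩

/-- If null lines on a surface meet one another so often that low-degree polynomials vanishing at
all the intersection points vanish on the lines, then all the lines lie in a common null quadric. -/
theorem exists_forall_inNullQuadric {F : MvPolynomial (Fin 3) K} (hF : Irreducible F)
    (hchar : ∀ n : ℕ, 0 < n → n ≤ F.totalDegree → (n : K) ≠ 0) (L : Finset (K × K × K))
    (hLF : ∀ q ∈ L, nullRestrict q F = 0)
    (hmin : ∀ G : MvPolynomial (Fin 3) K, (∀ q ∈ L, nullRestrict q G = 0) →
      G.totalDegree < F.totalDegree → G = 0)
    (hrich : ∀ G : MvPolynomial (Fin 3) K, G.totalDegree ≤ 4 * F.totalDegree →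
      (∀ P, RichPoint L P → eval P G = 0) → ∀ q ∈ L, nullRestrict q G = 0)
    (hn : 4 * F.totalDegree ^ 2 + 3 ≤ #L) :
    ∃ t : K × K × K × K × K, t ≠ 0 ∧ ∀ q ∈ L, InNullQuadric t q := by
  classical
  set D := F.totalDegree with hD
  have hDpos : 0 < D := by
    rw [Nat.pos_iff_ne_zero]
    intro h0
    obtain hC := totalDegree_eq_zero_iff_eq_C.1 h0
    apply hF.not_isUnit
    rw [hC]
    refine (isUnit_iff_ne_zero.2 fun h => hF.ne_zero ?_).map C
    rw [hC, h, map_zero]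
  have hdeg : ∀ i, (pderiv i F).totalDegree ≤ D - 1 := fun i => totalDegree_pderiv_le_sub_one i F
  have hdeg2 : ∀ i j, (pderiv i (pderiv j F)).totalDegree ≤ D := fun i j =>
    (totalDegree_pderiv_le_sub_one i _).trans ((Nat.sub_le _ _).trans ((hdeg j).trans (by omega)))
  have hlow : ∀ i, (∀ P, RichPoint L P → eval P (pderiv i F) = 0) → pderiv i F = 0 := by
    intro i h
    refine hmin _ (hrich _ ((hdeg i).trans (by omega)) h) ((hdeg i).trans_lt (by omega))
  -- values of the gradient and of the Hessian at rich points
  have hpt : ∀ P, RichPoint L P → ∃ s s' : K, s ≠ s' ∧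
      eval P (pderiv 1 F) = eval P (pderiv 0 F) * (s + s') ∧
      eval P (pderiv 2 F) = eval P (pderiv 0 F) * (s * s') ∧
      eval P (slopeRemainderOne F) = 0 ∧ eval P (slopeRemainderZero F) = 0 := by
    rintro P ⟨q, hq, q', hq', hne, hP, hP'⟩
    have hs : q.1 ≠ q'.1 := fun h => hne (onNullLine_ext hP hP' h)
    have hs' : q.1 - q'.1 ≠ 0 := sub_ne_zero.2 hs
    have g1 := gradient_of_onNullLine hP (hLF q hq)
    have g2 := gradient_of_onNullLine hP' (hLF q' hq')
    have H1 := hessian_of_onNullLine hP (hLF q hq)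
    have H2 := hessian_of_onNullLine hP' (hLF q' hq')
    have hb : eval P (pderiv 1 F) = eval P (pderiv 0 F) * (q.1 + q'.1) := by
      refine mul_left_cancel₀ hs' ?_
      linear_combination -g1 + g2
    have hc : eval P (pderiv 2 F) = eval P (pderiv 0 F) * (q.1 * q'.1) := by
      rw [hb] at g1
      linear_combination g1
    have r1 : ∀ s : K, eval P (pderiv 0 F) * s ^ 2 - eval P (pderiv 1 F) * s +
          eval P (pderiv 2 F) = 0 →
        eval P (pderiv 0 (pderiv 0 F)) * s ^ 4 - 2 * eval P (pderiv 0 (pderiv 1 F)) * s ^ 3 +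
          (eval P (pderiv 1 (pderiv 1 F)) + 2 * eval P (pderiv 0 (pderiv 2 F))) * s ^ 2 -
            2 * eval P (pderiv 1 (pderiv 2 F)) * s + eval P (pderiv 2 (pderiv 2 F)) = 0 →
        eval P (slopeRemainderOne F) * s + eval P (slopeRemainderZero F) = 0 := by
      intro s hg hh
      simp only [slopeRemainderOne, slopeRemainderZero, map_add, map_sub, map_mul, map_pow, map_neg,
        map_ofNat]
      linear_combination eval P (pderiv 0 F) ^ 3 * hh -
        (eval P (pderiv 0 F) ^ 2 * eval P (pderiv 0 (pderiv 0 F)) * s ^ 2 +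
        (-2 * eval P (pderiv 0 (pderiv 1 F)) * eval P (pderiv 0 F) ^ 2 +
          eval P (pderiv 0 (pderiv 0 F)) * eval P (pderiv 0 F) * eval P (pderiv 1 F)) * s +
        ((eval P (pderiv 1 (pderiv 1 F)) + 2 * eval P (pderiv 0 (pderiv 2 F))) *
            eval P (pderiv 0 F) ^ 2 -
          2 * eval P (pderiv 0 (pderiv 1 F)) * eval P (pderiv 0 F) * eval P (pderiv 1 F) +
          eval P (pderiv 0 (pderiv 0 F)) * (eval P (pderiv 1 F) ^ 2 -
            eval P (pderiv 0 F) * eval P (pderiv 2 F)))) * hg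
    have k1 := r1 _ g1 H1
    have k2 := r1 _ g2 H2
    have k3 : eval P (slopeRemainderOne F) = 0 := by
      refine mul_left_cancel₀ hs' ?_
      linear_combination k1 - k2
    refine ⟨q.1, q'.1, hs, hb, hc, k3, ?_⟩
    rw [k3] at k1
    linear_combination k1
  have hx : pderiv 0 F ≠ 0 := by
    intro hx
    have hzero : ∀ i, pderiv i F = 0 := by
      intro i
      fin_cases i
      · exact hx
      · refine hlow 1 fun P hP => ?_
        obtain ⟨s, s', -, h, -⟩ := hpt P hP
        rw [h, hx, map_zero, zero_mul]
      · refine hlow 2 fun P hP => ?_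
        obtain ⟨s, s', -, -, h, -⟩ := hpt P hP
        rw [h, hx, map_zero, zero_mul]
    obtain ⟨a, ha⟩ := exists_eq_C_of_pderiv_eq_zero hchar hzero
    rw [hD, ha, totalDegree_C] at hDpos
    exact lt_irrefl _ hDpos
  have hxdvd : ¬ F ∣ pderiv 0 F := by
    intro h
    have h1 := totalDegree_le_of_dvd_of_isDomain h hx
    have h2 := hdeg 0
    omega
  have hdegmul : ∀ {G H : MvPolynomial (Fin 3) K} {m n : ℕ}, G.totalDegree ≤ m →
      H.totalDegree ≤ n → (G * H).totalDegree ≤ m + n := fun hG hH =>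
    (totalDegree_mul _ _).trans (add_le_add hG hH)
  have hdegadd : ∀ {G H : MvPolynomial (Fin 3) K} {m : ℕ}, G.totalDegree ≤ m →
      H.totalDegree ≤ m → (G + H).totalDegree ≤ m := fun hG hH =>
    (totalDegree_add _ _).trans (max_le hG hH)
  have hdegsub : ∀ {G H : MvPolynomial (Fin 3) K} {m : ℕ}, G.totalDegree ≤ m →
      H.totalDegree ≤ m → (G - H).totalDegree ≤ m := fun hG hH =>
    (totalDegree_sub _ _).trans (max_le hG hH)
  have hdeg' : ∀ i, (pderiv i F).totalDegree ≤ D := fun i => (hdeg i).trans (by omega)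
  have hdegpow : ∀ (i : Fin 3) (k : ℕ), (pderiv i F ^ k).totalDegree ≤ k * D := fun i k =>
    (totalDegree_pow _ _).trans (Nat.mul_le_mul_left _ (hdeg' i))
  have hdegtwo : ∀ {G : MvPolynomial (Fin 3) K} {m : ℕ}, G.totalDegree ≤ m →
      (2 * G).totalDegree ≤ m := by
    intro G m hG
    rw [two_mul]
    exact hdegadd hG hG
  have hdegfour : ∀ {G : MvPolynomial (Fin 3) K} {m : ℕ}, G.totalDegree ≤ m →
      (4 * G).totalDegree ≤ m := by
    intro G m hG
    rw [show (4 : MvPolynomial (Fin 3) K) * G = 2 * (2 * G) by ring]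
    exact hdegtwo (hdegtwo hG)
  have hdisc : ¬ F ∣ pderiv 1 F ^ 2 - 4 * pderiv 0 F * pderiv 2 F := by
    rintro ⟨G, hG⟩
    refine hx (hlow 0 fun P hP => ?_)
    obtain ⟨s, s', hs, h1, h2, -⟩ := hpt P hP
    have h3 := congrArg (eval P) hG
    obtain ⟨q, hq, -, -, -, hPq, -⟩ := hP
    have h4 : eval P F = 0 := by rw [← eval_nullRestrict hPq, hLF q hq, Polynomial.eval_zero]
    simp only [map_sub, map_mul, map_pow, map_ofNat, h1, h2, h4, zero_mul] at h3
    have h5 : (eval P (pderiv 0 F) * (s - s')) ^ 2 = 0 := by linear_combination h3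
    exact (mul_eq_zero.1 (pow_eq_zero_iff two_ne_zero |>.1 h5)).resolve_right (sub_ne_zero.2 hs)
  have hdvd : ∀ G : MvPolynomial (Fin 3) K, G.totalDegree ≤ 4 * D →
      (∀ P, RichPoint L P → eval P G = 0) → F ∣ G := by
    intro G hG h
    by_contra hnd
    have h1 := card_le_of_nullRestrict_eq_zero hF hnd L hLF (hrich G hG h)
    have h2 : F.totalDegree * G.totalDegree ≤ D * (4 * D) := Nat.mul_le_mul_left _ hG
    nlinarith
  have hr1 : F ∣ slopeRemainderOne F := by
    refine hdvd _ ?_ fun P hP => ?_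
    · rw [slopeRemainderOne, show 2 * pderiv 0 F * pderiv 1 F * pderiv 2 F =
          2 * (pderiv 0 F * pderiv 1 F * pderiv 2 F) by ring,
        show 2 * pderiv 0 (pderiv 1 F) * pderiv 0 F * (pderiv 1 F ^ 2 - pderiv 0 F * pderiv 2 F) =
          2 * (pderiv 0 (pderiv 1 F) * (pderiv 0 F * (pderiv 1 F ^ 2 - pderiv 0 F * pderiv 2 F)))
          by ring,
        show (pderiv 1 (pderiv 1 F) + 2 * pderiv 0 (pderiv 2 F)) * pderiv 0 F ^ 2 * pderiv 1 F =
          (pderiv 1 (pderiv 1 F) + 2 * pderiv 0 (pderiv 2 F)) * (pderiv 0 F ^ 2 * pderiv 1 F)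
          by ring,
        show 2 * pderiv 1 (pderiv 2 F) * pderiv 0 F ^ 3 =
          2 * (pderiv 1 (pderiv 2 F) * pderiv 0 F ^ 3) by ring,
        show 4 * D = D + (D + 2 * D) by ring]
      refine hdegsub (hdegadd (hdegsub (hdegmul (hdeg2 _ _) (hdegsub ?_ (hdegtwo ?_)))
        (hdegtwo (hdegmul (hdeg2 _ _) (hdegmul (hdeg' _) (hdegsub (hdegpow _ _) ?_)))))
        (hdegmul (hdegadd (hdeg2 _ _) (hdegtwo (hdeg2 _ _))) ?_)) (hdegtwo (hdegmul (hdeg2 _ _) ?_))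
      · exact (hdegpow _ _).trans (by omega)
      · exact (hdegmul (hdegmul (hdeg' _) (hdeg' _)) (hdeg' _)).trans (by omega)
      · exact (hdegmul (hdeg' _) (hdeg' _)).trans (by omega)
      · exact (hdegmul (hdegpow _ _) (hdeg' _)).trans (by omega)
      · exact (hdegpow _ _).trans (by omega)
    · obtain ⟨s, s', -, -, -, h, -⟩ := hpt P hP
      exact h
  have hr0 : F ∣ slopeRemainderZero F := by
    refine hdvd _ ?_ fun P hP => ?_
    · rw [slopeRemainderZero,
        show pderiv 0 (pderiv 0 F) * (pderiv 1 F ^ 2 - pderiv 0 F * pderiv 2 F) * pderiv 2 F =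
          pderiv 0 (pderiv 0 F) * (pderiv 2 F * (pderiv 1 F ^ 2 - pderiv 0 F * pderiv 2 F)) by ring,
        show 2 * pderiv 0 (pderiv 1 F) * pderiv 0 F * pderiv 1 F * pderiv 2 F =
          2 * (pderiv 0 (pderiv 1 F) * (pderiv 0 F * (pderiv 1 F * pderiv 2 F))) by ring,
        show (pderiv 1 (pderiv 1 F) + 2 * pderiv 0 (pderiv 2 F)) * pderiv 0 F ^ 2 * pderiv 2 F =
          (pderiv 1 (pderiv 1 F) + 2 * pderiv 0 (pderiv 2 F)) * (pderiv 0 F ^ 2 * pderiv 2 F)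
          by ring,
        show 4 * D = D + (D + (D + D)) by ring]
      refine hdegadd (hdegsub (hdegadd ?_ (hdegtwo (hdegmul (hdeg2 _ _) (hdegmul (hdeg' _)
        (hdegmul (hdeg' _) (hdeg' _)))))) (hdegmul (hdegadd (hdeg2 _ _) (hdegtwo (hdeg2 _ _))) ?_))
        (hdegmul (hdeg2 _ _) ?_)
      · rw [totalDegree_neg]
        refine hdegmul (hdeg2 _ _) (hdegmul (hdeg' _) (hdegsub ?_ (hdegmul (hdeg' _) (hdeg' _))))
        exact (hdegpow _ _).trans (by omega)
      · exact (hdegmul (hdegpow _ _) (hdeg' _)).trans (by omega)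
      · exact (hdegpow _ _).trans (by omega)
    · obtain ⟨s, s', -, -, -, -, h⟩ := hpt P hP
      exact h
  -- the lines along which the two null directions are well defined and distinct
  let B1 := L.filter fun q => nullRestrict q (pderiv 0 F) = 0
  let B2 := L.filter fun q => nullRestrict q (pderiv 1 F ^ 2 - 4 * pderiv 0 F * pderiv 2 F) = 0
  have hB1 : #B1 ≤ D * D := by
    refine (card_le_of_nullRestrict_eq_zero hF hxdvd B1 (fun q hq => hLF q (mem_filter.1 hq).1)
      (fun q hq => (mem_filter.1 hq).2)).trans (Nat.mul_le_mul_left _ (hdeg' 0))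
  have hB2 : #B2 ≤ D * (2 * D) := by
    refine (card_le_of_nullRestrict_eq_zero hF hdisc B2 (fun q hq => hLF q (mem_filter.1 hq).1)
      (fun q hq => (mem_filter.1 hq).2)).trans (Nat.mul_le_mul_left _ ?_)
    rw [mul_assoc]
    refine hdegsub (hdegpow _ _) (hdegfour ?_)
    exact (hdegmul (hdeg' _) (hdeg' _)).trans (by omega)
  have hgood : 2 < #(L \ (B1 ∪ B2)) := by
    have h1 := le_card_sdiff (B1 ∪ B2) L
    have h2 := card_union_le B1 B2
    have h3 : D ^ 2 = D * D := sq D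
    have h4 : D * (2 * D) = 2 * (D * D) := by ring
    omega
  obtain ⟨a, b, c, ha, hb, hc, hab, hac, hbc⟩ := two_lt_card_iff.1 hgood
  have hform : ∀ q ∈ L \ (B1 ∪ B2), F ∣ nullForm F q := by
    intro q hq
    rw [mem_sdiff, mem_union, not_or] at hq
    refine dvd_nullForm hF hchar hr1 hr0 (hLF q hq.1) (fun h => hq.2.1 ?_) (fun h => hq.2.2 ?_)
    · exact mem_filter.2 ⟨hq.1, h⟩
    · exact mem_filter.2 ⟨hq.1, h⟩
  obtain ⟨wa, hwa⟩ := hform a ha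
  obtain ⟨wb, hwb⟩ := hform b hb
  obtain ⟨wc, hwc⟩ := hform c hc
  let E : K × K × K → K × K × K → MvPolynomial (Fin 3) K := fun q q' =>
    nullLinearOne q * nullLinearTwo q' - nullLinearOne q' * nullLinearTwo q
  have hprod : F ∣ E a b * E b c * E c a * pderiv 0 F := by
    refine ⟨-(wa * (nullLinearTwo b * nullLinearTwo c * E b c) +
      wb * (nullLinearTwo c * nullLinearTwo a * E c a) +
      wc * (nullLinearTwo a * nullLinearTwo b * E a b)), ?_⟩
    simp only [nullForm] at hwa hwb hwc
    simp only [E]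
    linear_combination -(nullLinearTwo b * nullLinearTwo c * E b c) * hwa -
      (nullLinearTwo c * nullLinearTwo a * E c a) * hwb -
      (nullLinearTwo a * nullLinearTwo b * E a b) * hwc
  have hfin : ∀ q q', q ≠ q' → F ∣ E q q' →
      ∃ t : K × K × K × K × K, t ≠ 0 ∧ ∀ q ∈ L, InNullQuadric t q := by
    rintro q q' hne ⟨G, hG⟩
    refine ⟨transversalQuadric q q', transversalQuadric_ne_zero hne, fun r hr => ?_⟩
    refine inNullQuadric_transversalQuadric ?_
    change nullRestrict r (E q q') = 0
    rw [hG, map_mul, hLF r hr, zero_mul]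
  rcases hF.prime.dvd_or_dvd hprod with h | h
  · rcases hF.prime.dvd_or_dvd h with h | h
    · rcases hF.prime.dvd_or_dvd h with h | h
      · exact hfin a b hab h
      · exact hfin b c hbc h
    · exact hfin c a hac.symm h
  · exact absurd h hxdvd

end RichStructure

section RichPoints

open MvPolynomial

variable {K : Type*} [Field K]

lemma OnNullLine.ext_apply_two {q : K × K × K} {P P' : Fin 3 → K} (h : OnNullLine q P)
    (h' : OnNullLine q P') (h2 : P 2 = P' 2) : P = P' := by
  obtain ⟨h0, h1⟩ := h
  obtain ⟨h0', h1'⟩ := h'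
  have e1 : P 1 = P' 1 := by linear_combination h1 - h1' - q.1 * h2
  have e0 : P 0 = P' 0 := by linear_combination h0 - h0' - q.1 * e1
  funext i
  fin_cases i <;> assumption

lemma OnNullLine.eq_of_ne {q q' : K × K × K} {P P' : Fin 3 → K} (hne : q ≠ q')
    (h : OnNullLine q P) (h' : OnNullLine q P') (g : OnNullLine q' P) (g' : OnNullLine q' P') :
    P = P' := by
  refine h.ext_apply_two h' ?_
  have hs : q.1 - q'.1 ≠ 0 := sub_ne_zero.mpr fun hs => hne (onNullLine_ext h g hs)
  have : (q.1 - q'.1) * (P 2 - P' 2) = 0 := by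
    linear_combination h.2 - h'.2 - g.2 + g'.2
  exact sub_eq_zero.mp ((mul_eq_zero.mp this).resolve_left hs)

lemma card_le_totalDegree_of_nullRestrict_ne_zero {F : MvPolynomial (Fin 3) K} {q : K × K × K}
    (hF : nullRestrict q F ≠ 0) (Z : Finset (Fin 3 → K))
    (hZ : ∀ P ∈ Z, OnNullLine q P ∧ eval P F = 0) : #Z ≤ F.totalDegree := by
  classical
  by_contra! h
  have hinj : Set.InjOn (fun P : Fin 3 → K => P 2) Z := fun P hP P' hP' h2 =>
    (hZ P hP).1.ext_apply_two (hZ P' hP').1 h2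
  refine hF (Polynomial.eq_zero_of_natDegree_lt_card_of_eval_eq_zero' _
    (Z.image fun P => P 2) ?_ ?_)
  · simp only [mem_image]
    rintro x ⟨P, hP, rfl⟩
    rw [eval_nullRestrict (hZ P hP).1]
    exact (hZ P hP).2
  · rw [card_image_of_injOn hinj]
    exact (natDegree_nullRestrict_le q F).trans_lt h

lemma exists_ne_zero_nullRestrict_eq_zero (S : Finset (K × K × K)) (D : ℕ)
    (h : #S * (D + 1) < (D + 3).choose 3) :
    ∃ F : MvPolynomial (Fin 3) K, F ≠ 0 ∧ F.totalDegree ≤ D ∧ ∀ q ∈ S, nullRestrict q F = 0 := by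
  classical
  let φ : restrictTotalDegree (Fin 3) K D →ₗ[K] (S → Fin (D + 1) → K) :=
    { toFun := fun F q i => (nullRestrict q.1 F.1).coeff i
      map_add' := fun F G => by ext; simp
      map_smul' := fun a F => by ext; simp }
  have hfin := finrank_restrictTotalDegree_fin_three (K := K) D
  have hdim : Module.finrank K (S → Fin (D + 1) → K) = #S * (D + 1) := by
    rw [Module.finrank_pi_fintype]
    simp
  have : FiniteDimensional K (restrictTotalDegree (Fin 3) K D) :=
    Module.finite_of_finrank_pos (hfin ▸ Nat.choose_pos (by omega))
  have hker : LinearMap.ker φ ≠ ⊥ :=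
    LinearMap.ker_ne_bot_of_finrank_lt (by rw [hdim, hfin]; exact h)
  obtain ⟨F, hF, hF0⟩ := (Submodule.ne_bot_iff _).mp hker
  have hdeg : F.1.totalDegree ≤ D := (mem_restrictTotalDegree _ _ _).mp F.2
  refine ⟨F.1, fun h0 => hF0 (Subtype.ext h0), hdeg, fun q hq => ?_⟩
  ext i
  rw [Polynomial.coeff_zero]
  by_cases hi : i < D + 1
  · exact congrFun (congrFun (LinearMap.mem_ker.mp hF) ⟨q, hq⟩) ⟨i, hi⟩
  · exact Polynomial.coeff_eq_zero_of_natDegree_lt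
      ((natDegree_nullRestrict_le q F.1).trans_lt (by omega))

variable [Fintype K]

open Classical in
/-- The finite set of points lying on at least two of the null lines in `L`. -/
noncomputable def richPoints (L : Finset (K × K × K)) : Finset (Fin 3 → K) :=
  univ.filter (RichPoint L)

open Classical in
/-- The rich points of `L` on the null line `q`. -/
noncomputable def richPointsOn (L : Finset (K × K × K)) (q : K × K × K) : Finset (Fin 3 → K) :=
  (richPoints L).filter (OnNullLine q)

lemma mem_richPoints {L : Finset (K × K × K)} {P : Fin 3 → K} :
    P ∈ richPoints L ↔ RichPoint L P := by
  simp [richPoints]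

lemma mem_richPointsOn {L : Finset (K × K × K)} {q : K × K × K} {P : Fin 3 → K} :
    P ∈ richPointsOn L q ↔ RichPoint L P ∧ OnNullLine q P := by
  simp [richPointsOn, mem_richPoints]

lemma card_richPoints_le_erase [DecidableEq K] (L : Finset (K × K × K)) (q : K × K × K) :
    #(richPoints L) ≤ #(richPoints (L.erase q)) + #(richPointsOn L q) := by
  classical
  refine (card_le_card ?_).trans (card_union_le _ _)
  intro P hP
  rw [mem_union, mem_richPoints, mem_richPointsOn]
  rw [mem_richPoints] at hP
  by_cases hq : OnNullLine q P
  · exact Or.inr ⟨hP, hq⟩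
  · obtain ⟨a, ha, b, hb, hab, haP, hbP⟩ := hP
    refine Or.inl ⟨a, mem_erase.mpr ⟨?_, ha⟩, b, mem_erase.mpr ⟨?_, hb⟩, hab, haP, hbP⟩
    · rintro rfl; exact hq haP
    · rintro rfl; exact hq hbP

lemma card_richPoints_le_split (L : Finset (K × K × K)) (G : MvPolynomial (Fin 3) K)
    (B : Finset (K × K × K)) [DecidableEq K] (hB : ∀ q, q ∈ B ↔ q ∈ L ∧ nullRestrict q G ≠ 0) :
    #(richPoints L) ≤ #(richPoints (L \ B)) + #(richPoints B) + #B * G.totalDegree := by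
  classical
  have hsub : richPoints L ⊆ richPoints (L \ B) ∪ richPoints B ∪
      B.biUnion fun q => univ.filter fun P => OnNullLine q P ∧ eval P G = 0 := by
    intro P hP
    rw [mem_richPoints] at hP
    obtain ⟨a, ha, b, hb, hab, haP, hbP⟩ := hP
    simp only [mem_union, mem_richPoints, mem_biUnion, mem_filter, mem_univ, true_and]
    have mixed : ∀ x ∈ L, ∀ y ∈ L, x ∈ B → y ∉ B → OnNullLine x P → OnNullLine y P →
        ∃ q ∈ B, OnNullLine q P ∧ eval P G = 0 := by
      intro x _ y hy hxB hyB hxP hyP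
      refine ⟨x, hxB, hxP, ?_⟩
      have : nullRestrict y G = 0 := by
        by_contra h0
        exact hyB ((hB y).mpr ⟨hy, h0⟩)
      rw [← eval_nullRestrict hyP, this, Polynomial.eval_zero]
    by_cases haB : a ∈ B <;> by_cases hbB : b ∈ B
    · exact Or.inl (Or.inr ⟨a, haB, b, hbB, hab, haP, hbP⟩)
    · exact Or.inr (mixed a ha b hb haB hbB haP hbP)
    · exact Or.inr (mixed b hb a ha hbB haB hbP haP)
    · exact Or.inl (Or.inl ⟨a, mem_sdiff.mpr ⟨ha, haB⟩, b, mem_sdiff.mpr ⟨hb, hbB⟩, hab, haP, hbP⟩)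
  refine (card_le_card hsub).trans ((card_union_le _ _).trans ?_)
  refine add_le_add (card_union_le _ _) ?_
  refine card_biUnion_le_card_mul _ _ _ fun q hq => ?_
  exact card_le_totalDegree_of_nullRestrict_ne_zero ((hB q).mp hq).2 _ fun P hP => by
    simpa using hP

lemma exists_injOn_richPointsOn (L : Finset (K × K × K)) (q : K × K × K) :
    ∃ g : (Fin 3 → K) → K × K × K, Set.InjOn g (richPointsOn L q) ∧
      ∀ P ∈ richPointsOn L q, g P ∈ L ∧ g P ≠ q ∧ OnNullLine (g P) P := by
  have : ∀ P, ∃ q', P ∈ richPointsOn L q → q' ∈ L ∧ q' ≠ q ∧ OnNullLine q' P := by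
    intro P
    by_cases hP : P ∈ richPointsOn L q
    · obtain ⟨⟨a, ha, b, hb, hab, haP, hbP⟩, hqP⟩ := mem_richPointsOn.mp hP
      by_cases h : a = q
      · exact ⟨b, fun _ => ⟨hb, fun hb => hab (h.trans hb.symm), hbP⟩⟩
      · exact ⟨a, fun _ => ⟨ha, h, haP⟩⟩
    · exact ⟨q, fun h => absurd h hP⟩
  choose g hg using this
  refine ⟨g, fun P hP P' hP' h => ?_, hg⟩
  have h1 := hg P hP
  have h2 := hg P' hP'
  rw [← h] at h2
  exact OnNullLine.eq_of_ne h1.2.1 h1.2.2 h2.2.2 (mem_richPointsOn.mp hP).2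
    (mem_richPointsOn.mp hP').2

lemma card_richPointsOn_lt {L : Finset (K × K × K)} {q : K × K × K} (hq : q ∈ L) :
    #(richPointsOn L q) < #L := by
  classical
  obtain ⟨g, hg, hgL⟩ := exists_injOn_richPointsOn L q
  have : #(richPointsOn L q) ≤ #(L.erase q) := card_le_card_of_injOn g
    (fun P hP => by
      have := hgL P hP
      exact mem_erase.mpr ⟨this.2.1, this.1⟩) hg
  rw [card_erase_of_mem hq] at this
  have := card_pos.mpr ⟨q, hq⟩
  omega

lemma exists_ne_zero_nullRestrict_eq_zero_of_rich (L : Finset (K × K × K)) (D R M : ℕ)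
    (hR : ∀ q ∈ L, R ≤ #(richPointsOn L q)) (hRD : 2 * D ≤ R)
    (hM : (#L : ℝ) * (1 - R / (4 * #L)) ^ M * 2 ^ D < 1)
    (hMD : M * (D + 1) < (D + 3).choose 3) :
    ∃ F : MvPolynomial (Fin 3) K, F ≠ 0 ∧ F.totalDegree ≤ D ∧ ∀ q ∈ L, nullRestrict q F = 0 := by
  classical
  choose g hg hgL using exists_injOn_richPointsOn L
  obtain ⟨S, hSL, hS, hSN⟩ := exists_small_hitting_subset L
    (fun q => (richPointsOn L q).image (g q))
    (fun q _ => by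
      intro x hx
      obtain ⟨P, hP, rfl⟩ := mem_image.mp hx
      exact (hgL q P hP).1) D R M
    (fun q hq => by rw [card_image_of_injOn (hg q)]; exact hR q hq) hRD hM
  obtain ⟨F, hF0, hFD, hF⟩ := exists_ne_zero_nullRestrict_eq_zero S D
    ((Nat.mul_le_mul_right _ hS).trans_lt hMD)
  refine ⟨F, hF0, hFD, fun q hq => ?_⟩
  by_contra hne
  have hcard := card_le_totalDegree_of_nullRestrict_ne_zero hne
    ((richPointsOn L q).filter fun P => g q P ∈ S) fun P hP => by
      rw [mem_filter] at hP
      refine ⟨(mem_richPointsOn.mp hP.1).2, ?_⟩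
      rw [← eval_nullRestrict (hgL q P hP.1).2.2, hF _ hP.2, Polynomial.eval_zero]
  have h1 := hSN q hq
  have h2 : #((richPointsOn L q).image (g q) ∩ S) ≤
      #((richPointsOn L q).filter fun P => g q P ∈ S) := by
    refine (card_le_card ?_).trans (card_image_le (f := g q))
    intro x hx
    obtain ⟨hx1, hx2⟩ := mem_inter.mp hx
    obtain ⟨P, hP, rfl⟩ := mem_image.mp hx1
    exact mem_image_of_mem _ (mem_filter.mpr ⟨hP, hx2⟩)
  omega

end RichPoints

section RichPointsBound

open MvPolynomial

/-- Parameters for the degree reduction argument exist once `√n` is large. -/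
lemma exists_degree_reduction_parameters {n : ℕ} {s : ℝ} (hs : s ^ 2 = n) (hs22 : 2 ^ 22 ≤ s) :
    ∃ D R M : ℕ, (D : ℝ) ≤ s / 2 ^ 8 ∧ (R : ℝ) ≤ 2 ^ 22 * s ∧ 2 * D ≤ R ∧
      (n : ℝ) * (1 - R / (4 * n)) ^ M * 2 ^ D < 1 ∧ M * (D + 1) < (D + 3).choose 3 := by
  have hs0 : 0 < s := lt_of_lt_of_le (by norm_num) hs22
  have hn0 : (0 : ℝ) < n := hs ▸ by positivity
  refine ⟨⌊s / 2 ^ 8⌋₊, ⌊2 ^ 22 * s⌋₊, ⌊s ^ 2 / 2 ^ 20⌋₊, Nat.floor_le (by positivity),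
    Nat.floor_le (by positivity), ?_, ?_, ?_⟩
  · apply Nat.le_floor
    push_cast
    have := Nat.floor_le (show 0 ≤ s / 2 ^ 8 by positivity)
    linarith
  · set D := ⌊s / 2 ^ 8⌋₊
    set R := ⌊2 ^ 22 * s⌋₊
    set M := ⌊s ^ 2 / 2 ^ 20⌋₊
    have hD : (D : ℝ) ≤ s / 2 ^ 8 := Nat.floor_le (by positivity)
    have hR : (R : ℝ) ≥ 2 ^ 21 * s := by
      have := (Nat.lt_floor_add_one (2 ^ 22 * s))
      change 2 ^ 22 * s < R + 1 at this
      linarith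
    have hM : (M : ℝ) ≥ s ^ 2 / 2 ^ 21 := by
      have := (Nat.lt_floor_add_one (s ^ 2 / 2 ^ 20))
      change s ^ 2 / 2 ^ 20 < M + 1 at this
      have h2 : s ^ 2 ≥ 2 ^ 44 := by nlinarith
      linarith
    have hRn : (R : ℝ) / (4 * n) ≤ 1 := by
      rw [div_le_one (by positivity), ← hs]
      have : (R : ℝ) ≤ 2 ^ 22 * s := Nat.floor_le (by positivity)
      nlinarith
    have h1 : (1 - (R : ℝ) / (4 * n)) ^ M ≤ Real.exp (-(s / 4)) := by
      calc (1 - (R : ℝ) / (4 * n)) ^ M ≤ (Real.exp (-(R / (4 * n)))) ^ M := by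
            gcongr
            exact Real.one_sub_le_exp_neg _
        _ = Real.exp (-(R / (4 * n) * M)) := by
            rw [← Real.exp_nat_mul]; ring_nf
        _ ≤ _ := by
            apply Real.exp_le_exp.mpr
            apply neg_le_neg
            have e : s / 4 = 2 ^ 21 * s / (4 * n) * (s ^ 2 / 2 ^ 21) := by
              rw [← hs]; field_simp
            rw [e]
            gcongr
    have h2 : (2 : ℝ) ^ D ≤ Real.exp (s / 2 ^ 8) := by
      calc (2 : ℝ) ^ D ≤ (Real.exp 1) ^ D := by
            gcongr
            linarith [Real.add_one_le_exp (1 : ℝ)]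
        _ = Real.exp D := by rw [← Real.exp_nat_mul, mul_one]
        _ ≤ _ := Real.exp_le_exp.mpr hD
    have h3 : (n : ℝ) ≤ Real.exp (s / 8) := by
      have := Real.pow_div_factorial_le_exp (s / 8) (by positivity) 3
      refine le_trans ?_ this
      rw [← hs]
      have : (Nat.factorial 3 : ℝ) = 6 := by norm_num [Nat.factorial]
      rw [this, le_div_iff₀ (by norm_num)]
      have : s ^ 2 * 2 ^ 22 ≤ s ^ 2 * s := by gcongr
      nlinarith
    calc (n : ℝ) * (1 - R / (4 * n)) ^ M * 2 ^ D
        ≤ Real.exp (s / 8) * Real.exp (-(s / 4)) * Real.exp (s / 2 ^ 8) := by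
          gcongr
      _ = Real.exp (-(s / 8 - s / 2 ^ 8)) := by
          rw [← Real.exp_add, ← Real.exp_add]; ring_nf
      _ < 1 := by
          rw [Real.exp_lt_one_iff]
          linarith
  · set D := ⌊s / 2 ^ 8⌋₊
    set M := ⌊s ^ 2 / 2 ^ 20⌋₊
    have hD : s / 2 ^ 8 < D + 1 := Nat.lt_floor_add_one _
    have hM : (M : ℝ) ≤ s ^ 2 / 2 ^ 20 := Nat.floor_le (by positivity)
    have hc : 6 * (D + 3).choose 3 = (D + 3) * (D + 2) * (D + 1) := by
      have := Nat.descFactorial_eq_factorial_mul_choose (D + 3) 3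
      simp only [Nat.descFactorial, Nat.factorial] at this
      have e1 : D + 3 - 2 = D + 1 := by omega
      have e2 : D + 3 - 1 = D + 2 := by omega
      have e3 : D + 3 - 0 = D + 3 := by omega
      rw [e1, e2, e3] at this
      linarith
    have h6 : 6 * M < (D + 3) * (D + 2) := by
      have : (6 * M : ℝ) < (D + 3) * (D + 2) := by
        have : (s / 2 ^ 8) * (s / 2 ^ 8) < (D + 3) * (D + 2) := by
          apply mul_lt_mul'' <;> first | positivity | linarith
        nlinarith
      exact_mod_cast this
    nlinarith

lemma mul_sqrt_sub_add_mul_sqrt_le {n b D : ℝ} (hb : 0 ≤ b) (hbn : 2 * b ≤ n)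
    (hD : D ≤ √n) :
    2 ^ 22 * ((n - b) * √(n - b)) + 2 ^ 22 * (b * √b) + b * D ≤ 2 ^ 22 * (n * √n) := by
  have hn : 0 ≤ n := by linarith
  have h1 : √(n - b) ≤ √n := Real.sqrt_le_sqrt (by linarith)
  have h2 : √b ≤ 3 / 4 * √n := by
    rw [Real.sqrt_le_left (by positivity), mul_pow, Real.sq_sqrt hn]
    linarith
  have h3 : (n - b) * √(n - b) ≤ (n - b) * √n := by gcongr; linarith
  have h4 : b * √b ≤ b * (3 / 4 * √n) := by gcongr
  have h5 : b * D ≤ b * √n := by gcongr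
  have h6 : 0 ≤ b * √n := by positivity
  nlinarith

variable {K : Type*} [Field K] [Fintype K]

open Classical in
/-- A finite set of null lines with at most `k` lines in each null quadric determines
`O(n^{3/2} + k n)` rich points. -/
theorem card_richPoints_le (k : ℕ) (L : Finset (K × K × K))
    (hk : ∀ t, t ≠ 0 → #(L.filter (InNullQuadric t)) ≤ k)
    (hchar : ∀ m : ℕ, 0 < m → 4 * m ^ 2 ≤ #L → (m : K) ≠ 0) :
    (#(richPoints L) : ℝ) ≤ 2 ^ 22 * (#L * √(#L)) + k * #L := by
  induction hn : #L using Nat.strong_induction_on generalizing L with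
  | _ n ih =>
  subst hn
  have ih' : ∀ L' ⊆ L, #L' < #L → (#(richPoints L') : ℝ) ≤ 2 ^ 22 * (#L' * √(#L')) + k * #L' :=
    fun L' hL' hlt => ih _ hlt L'
      (fun t ht => (card_le_card (filter_subset_filter _ hL')).trans (hk t ht))
      (fun m hm h => hchar m hm (h.trans hlt.le)) rfl
  by_contra! hbig
  have hLne : L.Nonempty := by
    rw [nonempty_iff_ne_empty]
    rintro rfl
    have : richPoints (∅ : Finset (K × K × K)) = ∅ := by
      ext P
      simp [mem_richPoints, RichPoint]
    simp [this] at hbig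
  set s := √(#L : ℝ) with hs
  have hs2 : s ^ 2 = #L := Real.sq_sqrt (Nat.cast_nonneg _)
  have hsnn : 0 ≤ s := Real.sqrt_nonneg _
  have hrich : ∀ q ∈ L, 2 ^ 22 * s + k < #(richPointsOn L q) := by
    intro q hq
    have hcard : #(L.erase q) = #L - 1 := card_erase_of_mem hq
    have hpos := card_pos.mpr hLne
    have h1 := ih' (L.erase q) (erase_subset _ _) (by omega)
    have h2 : (#(richPoints L) : ℝ) ≤ #(richPoints (L.erase q)) + #(richPointsOn L q) := by
      exact_mod_cast card_richPoints_le_erase L q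
    have hcard' : (#(L.erase q) : ℝ) = #L - 1 := by
      rw [hcard, Nat.cast_sub hpos]; simp
    rw [hcard'] at h1
    have h3 : ((#L : ℝ) - 1) * √(#L - 1) ≤ (#L - 1) * s := by
      have : (1 : ℝ) ≤ #L := by exact_mod_cast hpos
      gcongr
      · rw [hs]; exact Real.sqrt_le_sqrt (by linarith)
    nlinarith
  obtain ⟨q₀, hq₀⟩ := hLne
  have hlt : (#(richPointsOn L q₀) : ℝ) < #L := by exact_mod_cast card_richPointsOn_lt hq₀
  have hn1 : 2 ^ 22 * s + k < #L := (hrich q₀ hq₀).trans hlt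
  have hs22 : 2 ^ 22 ≤ s := by
    have hk0 : (0 : ℝ) ≤ k := Nat.cast_nonneg _
    have : s * 2 ^ 22 < s * s := by nlinarith
    exact (lt_of_mul_lt_mul_left this hsnn).le
  have hkn : k < #L := by
    have : (k : ℝ) < #L := by nlinarith
    exact_mod_cast this
  obtain ⟨D, R, M, hD, hR, hRD, hM, hMD⟩ := exists_degree_reduction_parameters hs2 hs22
  obtain ⟨F₀, hF₀, hF₀D, hF₀L⟩ := exists_ne_zero_nullRestrict_eq_zero_of_rich L D R M
    (fun q hq => by
      have := hrich q hq
      have : (R : ℝ) ≤ #(richPointsOn L q) := by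
        have : (0 : ℝ) ≤ k := Nat.cast_nonneg _
        linarith
      exact_mod_cast this) hRD hM hMD
  have hex : ∃ d, ∃ F : MvPolynomial (Fin 3) K, F ≠ 0 ∧ F.totalDegree = d ∧
      ∀ q ∈ L, nullRestrict q F = 0 := ⟨_, F₀, hF₀, rfl, hF₀L⟩
  obtain ⟨F, hF0, hFd, hFL⟩ := Nat.find_spec hex
  have hmin : ∀ G, (∀ q ∈ L, nullRestrict q G = 0) → G.totalDegree < F.totalDegree → G = 0 := by
    intro G hG hlt
    by_contra hG0
    exact Nat.find_min hex (hFd ▸ hlt) ⟨G, hG0, rfl, hG⟩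
  have hFD : F.totalDegree ≤ D := by
    rw [hFd]
    exact (Nat.find_min' hex ⟨F₀, hF₀, rfl, hF₀L⟩).trans hF₀D
  have hFs : (F.totalDegree : ℝ) ≤ s / 2 ^ 8 := le_trans (by exact_mod_cast hFD) hD
  have hsplit : ∀ G : MvPolynomial (Fin 3) K, G.totalDegree ≤ F.totalDegree →
      (∃ q ∈ L, nullRestrict q G ≠ 0) →
      #L < 2 * #(L.filter fun q => nullRestrict q G ≠ 0) := by
    intro G hGF hG
    by_contra! hle
    set B := L.filter fun q => nullRestrict q G ≠ 0 with hB
    have hBL : B ⊆ L := filter_subset _ _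
    have hBpos : 0 < #B := by
      obtain ⟨q, hq, hqG⟩ := hG
      exact card_pos.mpr ⟨q, mem_filter.mpr ⟨hq, hqG⟩⟩
    have hsd : #(L \ B) = #L - #B := card_sdiff_of_subset hBL
    have hBc := card_le_card hBL
    have h1 := ih' B hBL (by omega)
    have h2 := ih' (L \ B) sdiff_subset (by omega)
    have h3 : (#(richPoints L) : ℝ) ≤
        #(richPoints (L \ B)) + #(richPoints B) + #B * G.totalDegree := by
      exact_mod_cast card_richPoints_le_split L G B fun q => by rw [hB, mem_filter]
    have hsd' : (#(L \ B) : ℝ) = #L - #B := by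
      rw [hsd, Nat.cast_sub hBc]
    rw [hsd'] at h2
    have hGs : (G.totalDegree : ℝ) ≤ √(#L : ℝ) := by
      have : (G.totalDegree : ℝ) ≤ F.totalDegree := by exact_mod_cast hGF
      rw [← hs]
      linarith
    have := mul_sqrt_sub_add_mul_sqrt_le (n := #L) (b := #B) (D := G.totalDegree)
      (Nat.cast_nonneg _) (by exact_mod_cast hle) hGs
    rw [← hs] at this
    linarith
  have hirr : Irreducible F := by
    refine ⟨fun hu => ?_, fun a b hab => ?_⟩
    · have := hu.map (nullRestrict q₀)
      rw [hFL q₀ hq₀] at this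
      exact not_isUnit_zero this
    · by_contra! hu
      subst hab
      have ha0 : a ≠ 0 := left_ne_zero_of_mul hF0
      have hb0 : b ≠ 0 := right_ne_zero_of_mul hF0
      have hdeg := totalDegree_mul_of_isDomain ha0 hb0
      have hpos : ∀ c : MvPolynomial (Fin 3) K, c ≠ 0 → ¬ IsUnit c → 0 < c.totalDegree := by
        intro c hc hcu
        by_contra! h0
        have hC := totalDegree_eq_zero_iff_eq_C.mp (Nat.le_zero.mp h0)
        refine hcu ?_
        rw [hC]
        refine (IsUnit.mk0 _ fun h => hc ?_).map C
        rw [hC, h, C_0]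
      have hapos := hpos a ha0 hu.1
      have hbpos := hpos b hb0 hu.2
      have hnv : ∀ c : MvPolynomial (Fin 3) K, c ≠ 0 → c.totalDegree < (a * b).totalDegree →
          ∃ q ∈ L, nullRestrict q c ≠ 0 := by
        intro c hc hlt
        by_contra! h
        exact hc (hmin c h hlt)
      have h1 := hsplit a (by omega) (hnv a ha0 (by omega))
      have h2 := hsplit b (by omega) (hnv b hb0 (by omega))
      have hdisj : Disjoint (L.filter fun q => nullRestrict q a ≠ 0)
          (L.filter fun q => nullRestrict q b ≠ 0) := by
        rw [disjoint_filter]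
        intro q hq ha hb
        have := hFL q hq
        rw [map_mul] at this
        exact (mul_ne_zero ha hb) this
      have h3 := card_le_card (union_subset (filter_subset (fun q => nullRestrict q a ≠ 0) L)
        (filter_subset (fun q => nullRestrict q b ≠ 0) L))
      rw [card_union_of_disjoint hdisj] at h3
      omega
  have hsq : (4 * F.totalDegree ^ 2 + 3 : ℝ) ≤ #L := by
    rw [← hs2]
    have : (F.totalDegree : ℝ) ^ 2 ≤ (s / 2 ^ 8) ^ 2 := by gcongr
    nlinarith
  have hsq' : 4 * F.totalDegree ^ 2 + 3 ≤ #L := by exact_mod_cast hsq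
  obtain ⟨t, ht, htL⟩ := exists_forall_inNullQuadric hirr
    (fun m hm hle => hchar m hm ((by gcongr : 4 * m ^ 2 ≤ 4 * F.totalDegree ^ 2).trans (by omega)))
    L hFL hmin (fun G hG hGP q hq => by
      by_contra hne
      have h1 := card_le_totalDegree_of_nullRestrict_ne_zero hne (richPointsOn L q)
        fun P hP => ⟨(mem_richPointsOn.mp hP).2, hGP P (mem_richPointsOn.mp hP).1⟩
      have h2 := hrich q hq
      have h3 : (#(richPointsOn L q) : ℝ) ≤ 4 * F.totalDegree := by exact_mod_cast h1.trans hG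
      have : (0 : ℝ) ≤ k := Nat.cast_nonneg _
      linarith) hsq'
  have := hk t ht
  rw [filter_true_of_mem htL] at this
  omega

end RichPointsBound

section NullLineFamilies

variable {K : Type*} [Field K]

lemma card_le_two_of_quadratic {a b c : K} (ha : a ≠ 0) (X : Finset K)
    (hX : ∀ x ∈ X, a * x ^ 2 + b * x + c = 0) : #X ≤ 2 := by
  by_contra! h
  have h0 : Polynomial.C a * Polynomial.X ^ 2 + Polynomial.C b * Polynomial.X +
      Polynomial.C c = 0 :=
    Polynomial.eq_zero_of_natDegree_lt_card_of_eval_eq_zero' _ X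
      (fun x hx => by simpa using hX x hx)
      (Polynomial.natDegree_quadratic_le.trans_lt h)
  have := congrArg (fun f => Polynomial.coeff f 2) h0
  simp at this
  exact ha this

open Classical in
lemma card_filter_inNullQuadric_le (S A B : Finset K) {t : K × K × K × K × K} (ht : t ≠ 0) :
    #((S ×ˢ A ×ˢ B).filter (InNullQuadric t)) ≤ 2 * #S + 2 * #B + #A := by
  obtain ⟨e, b, c, d, f⟩ := t
  have hmem : ∀ q ∈ (S ×ˢ A ×ˢ B).filter (InNullQuadric (e, b, c, d, f)),
      (q.1 ∈ S ∧ q.2.1 ∈ A ∧ q.2.2 ∈ B) ∧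
      e * (q.2.1 + q.1 * q.2.2) + b * q.1 ^ 2 - c * q.1 + d = 0 ∧
      -(e * q.2.2 ^ 2) + b * (q.2.1 - q.1 * q.2.2) + c * q.2.2 + f = 0 := by
    intro q hq
    simpa [InNullQuadric, mem_filter, mem_product] using hq
  set X := (S ×ˢ A ×ˢ B).filter (InNullQuadric (e, b, c, d, f)) with hX
  by_cases he : e = 0
  · subst he
    by_cases hb : b = 0
    · subst hb
      by_cases hc : c = 0
      · subst hc
        have : X = ∅ := by
          rw [eq_empty_iff_forall_notMem]
          intro q hq
          obtain ⟨-, h1, h2⟩ := hmem q hq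
          refine ht ?_
          simp only [zero_mul, sub_zero, neg_zero, add_zero, zero_add] at h1 h2
          simp [h1, h2]
        simp [this]
      · have : #X ≤ #A := by
          refine card_le_card_of_injOn (fun q => q.2.1) (fun q hq => (hmem q hq).1.2.1) ?_
          intro q hq q' hq' h
          obtain ⟨-, h1, h2⟩ := hmem q hq
          obtain ⟨-, h1', h2'⟩ := hmem q' hq'
          have e1 : q.1 = q'.1 := mul_left_cancel₀ hc (by linear_combination h1' - h1)
          have e2 : q.2.2 = q'.2.2 := mul_left_cancel₀ hc (by linear_combination h2 - h2')
          exact Prod.ext e1 (Prod.ext h e2)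
        omega
    · have : #X ≤ 2 * #B := by
        refine card_le_mul_card_image_of_maps_to (f := fun q => q.2.2)
          (fun q hq => (hmem q hq).1.2.2) 2 fun v _ => ?_
        have hinj : Set.InjOn (fun q : K × K × K => q.1) (X.filter fun q => q.2.2 = v) := by
          intro q hq q' hq' h
          obtain ⟨hq, hv⟩ := mem_filter.mp hq
          obtain ⟨hq', hv'⟩ := mem_filter.mp hq'
          obtain ⟨-, h1, h2⟩ := hmem q hq
          obtain ⟨-, h1', h2'⟩ := hmem q' hq'
          have h : q.1 = q'.1 := h
          have e1 : q.2.1 = q'.2.1 := by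
            refine mul_left_cancel₀ hb ?_
            rw [hv, h] at h2
            rw [hv'] at h2'
            linear_combination h2 - h2'
          exact Prod.ext h (Prod.ext e1 (hv.trans hv'.symm))
        rw [← card_image_of_injOn hinj]
        refine card_le_two_of_quadratic (b := -c) (c := d) hb _ ?_
        simp only [mem_image, mem_filter]
        rintro x ⟨q, ⟨hq, -⟩, rfl⟩
        linear_combination (hmem q hq).2.1
      omega
  · have : #X ≤ 2 * #S := by
      refine card_le_mul_card_image_of_maps_to (f := fun q => q.1)
        (fun q hq => (hmem q hq).1.1) 2 fun s _ => ?_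
      have hinj : Set.InjOn (fun q : K × K × K => q.2.2) (X.filter fun q => q.1 = s) := by
        intro q hq q' hq' h
        obtain ⟨hq, hv⟩ := mem_filter.mp hq
        obtain ⟨hq', hv'⟩ := mem_filter.mp hq'
        obtain ⟨-, h1, h2⟩ := hmem q hq
        obtain ⟨-, h1', h2'⟩ := hmem q' hq'
        have h : q.2.2 = q'.2.2 := h
        have e1 : q.2.1 = q'.2.1 := by
          refine mul_left_cancel₀ he ?_
          rw [hv, h] at h1
          rw [hv'] at h1'
          linear_combination h1 - h1'
        exact Prod.ext (hv.trans hv'.symm) (Prod.ext e1 h)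
      rw [← card_image_of_injOn hinj]
      refine card_le_two_of_quadratic (a := -(e * e)) (b := e * c - 2 * s * e * b)
        (c := e * f - b * (b * s ^ 2 - c * s + d)) (by simpa using he) _ ?_
      simp only [mem_image, mem_filter]
      rintro x ⟨q, ⟨hq, rfl⟩, rfl⟩
      obtain ⟨-, h1, h2⟩ := hmem q hq
      linear_combination e * h2 - b * h1
    omega

lemma OnNullLine.meet {q q' : K × K × K} {P : Fin 3 → K} (h : OnNullLine q P)
    (h' : OnNullLine q' P) : q.2.1 + q'.1 * q.2.2 = q'.2.1 + q.1 * q'.2.2 := by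
  obtain ⟨h0, h1⟩ := h
  obtain ⟨h0', h1'⟩ := h'
  linear_combination -h0 + h0' - q'.1 * h1 + q.1 * h1'

lemma exists_onNullLine_of_meet {q q' : K × K × K} (hs : q.1 ≠ q'.1)
    (h : q.2.1 + q'.1 * q.2.2 = q'.2.1 + q.1 * q'.2.2) :
    ∃ P, OnNullLine q P ∧ OnNullLine q' P := by
  have hs' : q.1 - q'.1 ≠ 0 := sub_ne_zero.mpr hs
  set z := (q.2.2 - q'.2.2) / (q.1 - q'.1) with hz
  have hz' : z * (q.1 - q'.1) = q.2.2 - q'.2.2 := div_mul_cancel₀ _ hs'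
  refine ⟨![q.2.1 - q.1 * (q.2.2 - q.1 * z), q.2.2 - q.1 * z, z], ⟨?_, ?_⟩, ?_, ?_⟩
  · simp
  · simp
  · simp
    linear_combination h + q.1 * hz' 
  · simp
    linear_combination -hz'

end NullLineFamilies

section DilatedEnergy

lemma card_filter_eq_eq_sum_sq {α β : Type*} [DecidableEq β] [Fintype β] (S : Finset α)
    (f : α → β) :
    #((S ×ˢ S).filter fun z => f z.1 = f z.2) = ∑ b, #(S.filter fun x => f x = b) ^ 2 := by
  classical
  rw [card_eq_sum_card_fiberwise (f := fun z => f z.1) (t := univ)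
    (fun _ _ => mem_coe.mpr (mem_univ _))]
  refine sum_congr rfl fun b _ => ?_
  rw [sq, ← card_product]
  congr 1
  ext z
  simp only [mem_filter, mem_product]
  constructor
  · rintro ⟨⟨⟨h1, h2⟩, h3⟩, h4⟩
    exact ⟨⟨h1, h4⟩, h2, h3 ▸ h4⟩
  · rintro ⟨⟨h1, h2⟩, h3, h4⟩
    exact ⟨⟨⟨h1, h3⟩, h2.trans h4.symm⟩, h2⟩

variable {K : Type*} [Field K] [DecidableEq K]

/-- The number of solutions of `a + μ b = c + μ d` with `a, b, c, d ∈ A`. -/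
def dilatedEnergy (μ : K) (A : Finset K) : ℕ :=
  #(((A ×ˢ A) ×ˢ (A ×ˢ A)).filter fun z => z.1.1 + μ * z.1.2 = z.2.1 + μ * z.2.2)

lemma dilatedEnergy_inv {μ : K} (hμ : μ ≠ 0) (A : Finset K) :
    dilatedEnergy μ⁻¹ A = dilatedEnergy μ A := by
  refine card_nbij' (fun z => (z.1.swap, z.2.swap)) (fun z => (z.1.swap, z.2.swap)) ?_ ?_ ?_ ?_
  · rintro ⟨⟨a, b⟩, c, d⟩ h
    simp only [coe_filter, mem_product, Set.mem_ofPred_eq, Prod.swap] at h ⊢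
    refine ⟨by tauto, ?_⟩
    have := congrArg (μ * ·) h.2
    simp only [mul_add, mul_inv_cancel_left₀ hμ] at this
    linear_combination this
  · rintro ⟨⟨a, b⟩, c, d⟩ h
    simp only [coe_filter, mem_product, Set.mem_ofPred_eq, Prod.swap] at h ⊢
    refine ⟨by tauto, ?_⟩
    have := congrArg (μ⁻¹ * ·) h.2
    simp only [mul_add, inv_mul_cancel_left₀ hμ] at this
    linear_combination this
  · intro z _; simp
  · intro z _; simp

lemma dilatedEnergy_eq_sum_sq [Fintype K] (μ : K) (A : Finset K) :
    dilatedEnergy μ A = ∑ x, #((A ×ˢ A).filter fun z => z.1 + μ * z.2 = x) ^ 2 :=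
  card_filter_eq_eq_sum_sq (A ×ˢ A) fun z => z.1 + μ * z.2

lemma card_pow_four_le_dilatedEnergy [Fintype K] (μ : K) (A : Finset K) :
    #A ^ 4 ≤ Fintype.card K * dilatedEnergy μ A := by
  rw [dilatedEnergy_eq_sum_sq]
  have h := sq_sum_le_card_mul_sum_sq (s := (univ : Finset K))
    (f := fun x => #((A ×ˢ A).filter fun z => z.1 + μ * z.2 = x))
  rw [← card_eq_sum_card_fiberwise (f := fun z : K × K => z.1 + μ * z.2) (t := univ)
    (fun _ _ => mem_coe.mpr (mem_univ _)), card_product, card_univ] at h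
  calc #A ^ 4 = (#A * #A) ^ 2 := by ring
    _ ≤ _ := h

lemma sum_dilatedEnergy_le [Fintype K] (A : Finset K) :
    ∑ μ ∈ univ.erase (0 : K), dilatedEnergy μ A ≤ (Fintype.card K - 1) * #A ^ 2 + #A ^ 4 := by
  have hswap : ∑ μ ∈ univ.erase (0 : K), dilatedEnergy μ A = ∑ z ∈ (A ×ˢ A) ×ˢ (A ×ˢ A),
      #((univ.erase (0 : K)).filter fun μ => z.1.1 + μ * z.1.2 = z.2.1 + μ * z.2.2) := by
    simp only [dilatedEnergy, card_filter]
    exact sum_comm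
  rw [hswap]
  have hle : ∀ z ∈ (A ×ˢ A) ×ˢ (A ×ˢ A),
      #((univ.erase (0 : K)).filter fun μ => z.1.1 + μ * z.1.2 = z.2.1 + μ * z.2.2) ≤
        (if z.1 = z.2 then (Fintype.card K - 1) else 0) + 1 := by
    intro z _
    split_ifs with h
    · refine (card_filter_le _ _).trans ?_
      rw [card_erase_of_mem (mem_univ _), card_univ]
      omega
    · rw [zero_add, card_le_one]
      intro μ hμ ν hν
      have h1 := (mem_filter.mp hμ).2
      have h2 := (mem_filter.mp hν).2
      have h3 : (μ - ν) * (z.1.2 - z.2.2) = 0 := by linear_combination h1 - h2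
      rcases mul_eq_zero.mp h3 with h4 | h4
      · exact sub_eq_zero.mp h4
      · refine absurd (Prod.ext ?_ (sub_eq_zero.mp h4)) h
        linear_combination h1 - μ * h4
  refine (sum_le_sum hle).trans (le_of_eq ?_)
  rw [sum_add_distrib, ← sum_filter, sum_const, sum_const, card_product, card_product]
  have : #(((A ×ˢ A) ×ˢ (A ×ˢ A)).filter fun z => z.1 = z.2) = #A ^ 2 := by
    rw [sq, ← card_product, ← diag_card (A ×ˢ A)]
    congr 1
    ext z
    simp only [mem_filter, mem_product, mem_diag]
    constructor
    · rintro ⟨⟨h1, -⟩, h2⟩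
      exact ⟨h1, h2⟩
    · rintro ⟨h1, h2⟩
      exact ⟨⟨h1, h2 ▸ h1⟩, h2⟩
  rw [this]
  simp only [smul_eq_mul, mul_one]
  ring

variable {Γ A : Finset K}

lemma card_filter_invariant_meet (hΓ0 : (0 : K) ∉ Γ) (hΓinv : ∀ x ∈ Γ, x⁻¹ ∈ Γ)
    (hA : ∀ g ∈ Γ, ∀ a ∈ A, g * a ∈ A) (μ : K) :
    #(((Γ ×ˢ A ×ˢ A) ×ˢ (Γ ×ˢ A ×ˢ A)).filter fun z =>
      z.1.2.1 + μ * (z.2.1 * z.1.2.2) = z.2.2.1 + μ * (z.1.1 * z.2.2.2)) =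
      #Γ ^ 2 * dilatedEnergy μ A := by
  have hne : ∀ g ∈ Γ, g ≠ 0 := fun g hg h => hΓ0 (h ▸ hg)
  rw [sq, ← card_product, dilatedEnergy, ← card_product]
  refine card_nbij'
    (fun z => ((z.1.1, z.2.1), ((z.1.2.1, z.2.1 * z.1.2.2), (z.2.2.1, z.1.1 * z.2.2.2))))
    (fun w => ((w.1.1, w.2.1.1, w.1.2⁻¹ * w.2.1.2), (w.1.2, w.2.2.1, w.1.1⁻¹ * w.2.2.2)))
    ?_ ?_ ?_ ?_
  · rintro ⟨⟨g, a, b⟩, h, c, d⟩ hz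
    simp only [coe_filter, mem_product, mem_coe, mem_filter, Set.mem_ofPred_eq] at hz ⊢
    obtain ⟨⟨⟨hg, ha, hb⟩, hh, hc, hd⟩, he⟩ := hz
    exact ⟨⟨hg, hh⟩, ⟨⟨ha, hA _ hh _ hb⟩, hc, hA _ hg _ hd⟩, he⟩
  · rintro ⟨⟨g, h⟩, ⟨a, b⟩, c, d⟩ hz
    simp only [coe_filter, mem_product, mem_coe, mem_filter, Set.mem_ofPred_eq] at hz ⊢
    obtain ⟨⟨hg, hh⟩, ⟨⟨ha, hb⟩, hc, hd⟩, he⟩ := hz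
    refine ⟨⟨⟨hg, ha, hA _ (hΓinv _ hh) _ hb⟩, hh, hc, hA _ (hΓinv _ hg) _ hd⟩, ?_⟩
    rw [mul_inv_cancel_left₀ (hne _ hh), mul_inv_cancel_left₀ (hne _ hg)]
    exact he
  · rintro ⟨⟨g, a, b⟩, h, c, d⟩ hz
    simp only [coe_filter, mem_product, Set.mem_ofPred_eq] at hz
    obtain ⟨⟨⟨hg, ha, hb⟩, hh, hc, hd⟩, he⟩ := hz
    simp [inv_mul_cancel_left₀ (hne _ hh), inv_mul_cancel_left₀ (hne _ hg)]
  · rintro ⟨⟨g, h⟩, ⟨a, b⟩, c, d⟩ hz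
    simp only [coe_product, coe_filter, mem_product, mem_coe, Set.mem_prod] at hz
    simp [mul_inv_cancel_left₀ (hne _ hz.1.1), mul_inv_cancel_left₀ (hne _ hz.1.2)]

lemma dilatedEnergy_of_mem (hΓ0 : (0 : K) ∉ Γ) (hΓinv : ∀ x ∈ Γ, x⁻¹ ∈ Γ)
    (hA : ∀ g ∈ Γ, ∀ a ∈ A, g * a ∈ A) {g : K} (hg : g ∈ Γ) :
    dilatedEnergy g A = dilatedEnergy 1 A := by
  have hne : g ≠ 0 := fun h => hΓ0 (h ▸ hg)
  refine card_nbij' (fun z => ((z.1.1, g * z.1.2), (z.2.1, g * z.2.2)))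
    (fun z => ((z.1.1, g⁻¹ * z.1.2), (z.2.1, g⁻¹ * z.2.2))) ?_ ?_ ?_ ?_
  · rintro ⟨⟨a, b⟩, c, d⟩ h
    simp only [coe_filter, mem_product, Set.mem_ofPred_eq, one_mul] at h ⊢
    exact ⟨⟨⟨h.1.1.1, hA _ hg _ h.1.1.2⟩, h.1.2.1, hA _ hg _ h.1.2.2⟩, h.2⟩
  · rintro ⟨⟨a, b⟩, c, d⟩ h
    simp only [coe_filter, mem_product, Set.mem_ofPred_eq, one_mul] at h ⊢
    refine ⟨⟨⟨h.1.1.1, hA _ (hΓinv _ hg) _ h.1.1.2⟩, h.1.2.1, hA _ (hΓinv _ hg) _ h.1.2.2⟩, ?_⟩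
    rw [mul_inv_cancel_left₀ hne, mul_inv_cancel_left₀ hne]
    exact h.2
  · intro z _; simp [inv_mul_cancel_left₀ hne]
  · intro z _; simp [mul_inv_cancel_left₀ hne]

end DilatedEnergy

section MeetingPairs

variable {K : Type*} [Field K] [DecidableEq K]

/-- The number of pairs of lines from `L × L'` satisfying the incidence equation. -/
def meetingPairs (L L' : Finset (K × K × K)) : ℕ :=
  #((L ×ˢ L').filter fun z => z.1.2.1 + z.2.1 * z.1.2.2 = z.2.2.1 + z.1.1 * z.2.2.2)

lemma meetingPairs_image {α : Type*} [DecidableEq α] (T : Finset α) {f g : α → K × K × K}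
    (hf : f.Injective) (hg : g.Injective) :
    meetingPairs (T.image f) (T.image g) = #((T ×ˢ T).filter fun z =>
      (f z.1).2.1 + (g z.2).1 * (f z.1).2.2 = (g z.2).2.1 + (f z.1).1 * (g z.2).2.2) := by
  rw [meetingPairs, ← prodMap_image_product, filter_image,
    card_image_of_injective _ (hf.prodMap hg)]
  rfl

open Classical in
lemma sum_card_offDiag_le_meetingPairs [Fintype K] (L : Finset (K × K × K)) :
    ∑ P : Fin 3 → K, #(L.filter fun q => OnNullLine q P).offDiag ≤ meetingPairs L L := by
  rw [← card_biUnion]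
  · refine card_le_card ?_
    intro z hz
    simp only [mem_biUnion, mem_univ, true_and, mem_offDiag, mem_filter] at hz
    obtain ⟨P, ⟨h1, h1P⟩, ⟨h2, h2P⟩, -⟩ := hz
    exact mem_filter.mpr ⟨mem_product.mpr ⟨h1, h2⟩, h1P.meet h2P⟩
  · intro P _ P' _ hPP'
    rw [Function.onFun, disjoint_left]
    intro z hz hz'
    simp only [mem_offDiag, mem_filter] at hz hz'
    exact hPP' (OnNullLine.eq_of_ne hz.2.2 hz.1.2 hz'.1.2 hz.2.1.2 hz'.2.1.2)

theorem meetingPairs_le [Fintype K] (L L' : Finset (K × K × K))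
    (hs : ∀ q ∈ L, ∀ q' ∈ L', q.1 ≠ q'.1) :
    meetingPairs L L' ≤ #(richPoints (L ∪ L')) + meetingPairs L L + meetingPairs L' L' := by
  classical
  let r : Finset (K × K × K) → (Fin 3 → K) → Finset (K × K × K) :=
    fun L P => L.filter fun q => OnNullLine q P
  have h1 : meetingPairs L L' ≤ ∑ P : Fin 3 → K, #(r L P) * #(r L' P) := by
    simp_rw [← card_product]
    refine le_trans (card_le_card ?_) card_biUnion_le
    intro z hz
    obtain ⟨hz, he⟩ := mem_filter.mp hz
    obtain ⟨hz1, hz2⟩ := mem_product.mp hz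
    obtain ⟨P, hP, hP'⟩ := exists_onNullLine_of_meet (hs _ hz1 _ hz2) he
    exact mem_biUnion.mpr ⟨P, mem_univ _, mem_product.mpr
      ⟨mem_filter.mpr ⟨hz1, hP⟩, mem_filter.mpr ⟨hz2, hP'⟩⟩⟩
  have h2 : ∀ P, #(r L P) * #(r L' P) ≤ (if RichPoint (L ∪ L') P then 1 else 0) +
      #(r L P).offDiag + #(r L' P).offDiag := by
    intro P
    rw [offDiag_card, offDiag_card]
    rcases Nat.eq_zero_or_pos (#(r L P)) with h0 | h0
    · simp [h0]
    rcases Nat.eq_zero_or_pos (#(r L' P)) with h0' | h0'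
    · simp [h0']
    have hrich : RichPoint (L ∪ L') P := by
      obtain ⟨q, hq⟩ := card_pos.mp h0
      obtain ⟨q', hq'⟩ := card_pos.mp h0'
      obtain ⟨hq, hqP⟩ := mem_filter.mp hq
      obtain ⟨hq', hqP'⟩ := mem_filter.mp hq'
      exact ⟨q, mem_union_left _ hq, q', mem_union_right _ hq',
        fun h => hs q hq q' hq' (congrArg Prod.fst h), hqP, hqP'⟩
    rw [if_pos hrich]
    generalize #(r L P) = a at *
    generalize #(r L' P) = b at *
    obtain ⟨a, rfl⟩ := Nat.exists_eq_add_of_lt h0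
    obtain ⟨b, rfl⟩ := Nat.exists_eq_add_of_lt h0'
    have e1 : (0 + a + 1) * (0 + a + 1) - (0 + a + 1) = (a + 1) * a := by
      rw [zero_add, ← Nat.mul_sub_one, Nat.add_sub_cancel]
    have e2 : (0 + b + 1) * (0 + b + 1) - (0 + b + 1) = (b + 1) * b := by
      rw [zero_add, ← Nat.mul_sub_one, Nat.add_sub_cancel]
    rw [e1, e2]
    zify
    nlinarith [sq_nonneg ((a : ℤ) - b), sq_nonneg (a : ℤ), sq_nonneg (b : ℤ)]
  have h3 : ∑ P : Fin 3 → K, (if RichPoint (L ∪ L') P then 1 else 0) = #(richPoints (L ∪ L')) := by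
    rw [richPoints, card_filter]
  calc meetingPairs L L' ≤ ∑ P : Fin 3 → K, #(r L P) * #(r L' P) := h1
    _ ≤ _ := sum_le_sum fun P _ => h2 P
    _ ≤ _ := by
      rw [sum_add_distrib, sum_add_distrib, h3]
      gcongr
      · exact sum_card_offDiag_le_meetingPairs L
      · exact sum_card_offDiag_le_meetingPairs L'

end MeetingPairs

section InvariantEnergy

variable {p : ℕ} [Fact p.Prime] {Γ A : Finset (ZMod p)}

lemma card_mul_dilatedEnergy_le (hΓ0 : 0 ∉ Γ) (hΓinv : ∀ x ∈ Γ, x⁻¹ ∈ Γ)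
    (hA : ∀ g ∈ Γ, ∀ a ∈ A, g * a ∈ A) :
    (#Γ : ℝ) * dilatedEnergy 1 A ≤ p * #A ^ 2 + (1 + #Γ) * (#A ^ 4 / p) := by
  have hp : (0 : ℝ) < p := by exact_mod_cast (Fact.out : p.Prime).pos
  have hsub : Γ ⊆ univ.erase (0 : ZMod p) := fun x hx =>
    mem_erase.mpr ⟨fun h => hΓ0 (h ▸ hx), mem_univ _⟩
  have hcard : #(univ.erase (0 : ZMod p)) = p - 1 := by
    rw [card_erase_of_mem (mem_univ _), card_univ, ZMod.card]
  have h1 : (∑ μ ∈ univ.erase (0 : ZMod p), (dilatedEnergy μ A : ℝ)) ≤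
      (p - 1) * #A ^ 2 + #A ^ 4 := by
    have := sum_dilatedEnergy_le A
    rw [ZMod.card] at this
    have h := (Nat.cast_le (α := ℝ)).mpr this
    push_cast [Nat.cast_sub (Fact.out : p.Prime).one_le] at h
    exact h
  have h2 : (#Γ : ℝ) * dilatedEnergy 1 A = ∑ μ ∈ Γ, (dilatedEnergy μ A : ℝ) := by
    rw [sum_congr rfl fun g hg => by rw [dilatedEnergy_of_mem hΓ0 hΓinv hA hg], sum_const,
      nsmul_eq_mul]
  have h3 : ((p : ℝ) - 1 - #Γ) * (#A ^ 4 / p) ≤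
      ∑ μ ∈ univ.erase (0 : ZMod p) \ Γ, (dilatedEnergy μ A : ℝ) := by
    have hc : (#(univ.erase (0 : ZMod p) \ Γ) : ℝ) = p - 1 - #Γ := by
      rw [cast_card_sdiff hsub, hcard, Nat.cast_sub (Fact.out : p.Prime).one_le, Nat.cast_one]
    rw [← hc, ← nsmul_eq_mul]
    refine card_nsmul_le_sum _ _ _ fun μ _ => ?_
    rw [div_le_iff₀ hp, mul_comm]
    have := card_pow_four_le_dilatedEnergy μ A
    rw [ZMod.card] at this
    exact_mod_cast this
  have h4 := sum_sdiff (f := fun μ => (dilatedEnergy μ A : ℝ)) hsub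
  have h5 : (p : ℝ) * (#A ^ 4 / p) = #A ^ 4 := mul_div_cancel₀ _ hp.ne'
  nlinarith [sq_nonneg (#A : ℝ)]

lemma exists_dilatedEnergy_le (A : Finset (ZMod p)) : ∃ μ : ZMod p, μ ≠ 0 ∧
    (dilatedEnergy μ A : ℝ) ≤ #A ^ 2 + 2 * (#A ^ 4 / p) := by
  have hp : (0 : ℝ) < p := by exact_mod_cast (Fact.out : p.Prime).pos
  have hp2 : (2 : ℝ) ≤ p := by exact_mod_cast (Fact.out : p.Prime).two_le
  have hcard : #(univ.erase (0 : ZMod p)) = p - 1 := by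
    rw [card_erase_of_mem (mem_univ _), card_univ, ZMod.card]
  by_contra! hcon
  have h1 : (∑ μ ∈ univ.erase (0 : ZMod p), (dilatedEnergy μ A : ℝ)) ≤
      (p - 1) * #A ^ 2 + #A ^ 4 := by
    have := sum_dilatedEnergy_le A
    rw [ZMod.card] at this
    have h := (Nat.cast_le (α := ℝ)).mpr this
    push_cast [Nat.cast_sub (Fact.out : p.Prime).one_le] at h
    exact h
  have h2 : ∑ μ ∈ univ.erase (0 : ZMod p), ((#A : ℝ) ^ 2 + 2 * (#A ^ 4 / p)) <
      ∑ μ ∈ univ.erase (0 : ZMod p), (dilatedEnergy μ A : ℝ) :=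
    sum_lt_sum_of_nonempty ⟨1, by simp⟩ fun μ hμ => hcon μ (ne_of_mem_erase hμ)
  rw [sum_const, hcard, nsmul_eq_mul, Nat.cast_sub (Fact.out : p.Prime).one_le, Nat.cast_one] at h2
  have h5 : (p : ℝ) * (#A ^ 4 / p) = #A ^ 4 := mul_div_cancel₀ _ hp.ne'
  have h6 : 0 ≤ (#A : ℝ) ^ 4 / p := by positivity
  nlinarith

lemma card_sq_mul_dilatedEnergy_le (hΓ0 : 0 ∉ Γ)
    (hΓmul : ∀ x ∈ Γ, ∀ y ∈ Γ, x * y ∈ Γ) (hΓinv : ∀ x ∈ Γ, x⁻¹ ∈ Γ)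
    (hA : ∀ g ∈ Γ, ∀ a ∈ A, g * a ∈ A) {ξ : ZMod p} (hξ0 : ξ ≠ 0) (hξ : ξ ∉ Γ)
    (hsmall : #Γ * #A ^ 2 ≤ p ^ 2) :
    (#Γ : ℝ) ^ 2 * dilatedEnergy 1 A ≤ 2 ^ 22 * ((2 * #Γ * #A ^ 2) * √(2 * #Γ * #A ^ 2)) +
      (4 * #Γ + 4 * #A + 2 * #A) * (2 * #Γ * #A ^ 2) + 2 * (#Γ ^ 2 * dilatedEnergy ξ A) := by
  classical
  set T := Γ ×ˢ A ×ˢ A with hT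
  let f : ZMod p × ZMod p × ZMod p → ZMod p × ZMod p × ZMod p := fun x => (ξ * x.1, x.2.1, x.2.2)
  let g : ZMod p × ZMod p × ZMod p → ZMod p × ZMod p × ZMod p := fun x => (x.1, x.2.1, ξ⁻¹ * x.2.2)
  have hf : f.Injective := by
    rintro ⟨a, b, c⟩ ⟨a', b', c'⟩ h
    simp only [f, Prod.mk.injEq, mul_right_inj' hξ0] at h
    simp [h]
  have hg : g.Injective := by
    rintro ⟨a, b, c⟩ ⟨a', b', c'⟩ h
    simp only [g, Prod.mk.injEq, mul_right_inj' (inv_ne_zero hξ0)] at h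
    simp [h]
  have hTcard : #T = #Γ * #A ^ 2 := by rw [hT, card_product, card_product, sq]
  have hfg : meetingPairs (T.image f) (T.image g) = #Γ ^ 2 * dilatedEnergy 1 A := by
    rw [meetingPairs_image T hf hg, ← card_filter_invariant_meet hΓ0 hΓinv hA]
    congr 1
    refine filter_congr fun z _ => ?_
    have : ξ * z.1.1 * (ξ⁻¹ * z.2.2.2) = 1 * (z.1.1 * z.2.2.2) := by field_simp
    simp only [f, g, this, one_mul]
  have hff : meetingPairs (T.image f) (T.image f) = #Γ ^ 2 * dilatedEnergy ξ A := by
    rw [meetingPairs_image T hf hf, ← card_filter_invariant_meet hΓ0 hΓinv hA]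
    congr 1
    refine filter_congr fun z _ => ?_
    simp only [f, mul_assoc]
  have hgg : meetingPairs (T.image g) (T.image g) = #Γ ^ 2 * dilatedEnergy ξ A := by
    rw [← dilatedEnergy_inv hξ0, meetingPairs_image T hg hg,
      ← card_filter_invariant_meet hΓ0 hΓinv hA]
    congr 1
    refine filter_congr fun z _ => ?_
    simp only [g, mul_left_comm]
  have hs : ∀ q ∈ T.image f, ∀ q' ∈ T.image g, q.1 ≠ q'.1 := by
    simp only [mem_image]
    rintro _ ⟨x, hx, rfl⟩ _ ⟨y, hy, rfl⟩ h
    have hx1 : x.1 ∈ Γ := (mem_product.mp hx).1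
    have hy1 : y.1 ∈ Γ := (mem_product.mp hy).1
    have h : ξ * x.1 = y.1 := h
    have hx0 : x.1 ≠ 0 := fun h0 => hΓ0 (h0 ▸ hx1)
    refine hξ ?_
    rw [(eq_mul_inv_iff_mul_eq₀ hx0).mpr h]
    exact hΓmul _ hy1 _ (hΓinv _ hx1)
  have hmain := meetingPairs_le (T.image f) (T.image g) hs
  rw [hfg, hff, hgg] at hmain
  set L := T.image f ∪ T.image g with hL
  have hLcard : #L ≤ 2 * (#Γ * #A ^ 2) := by
    have h1 : #L ≤ _ := card_union_le (T.image f) (T.image g)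
    have h2 : #(T.image f) ≤ #T := card_image_le
    have h3 : #(T.image g) ≤ #T := card_image_le
    rw [hTcard] at h2 h3
    omega
  have hquad : ∀ t, t ≠ 0 → #(L.filter (InNullQuadric t)) ≤ 4 * #Γ + 4 * #A + 2 * #A := by
    intro t ht
    have h1 : L ⊆ (Γ.image (ξ * ·)) ×ˢ A ×ˢ A ∪ Γ ×ˢ A ×ˢ A.image (ξ⁻¹ * ·) := by
      refine union_subset_union ?_ ?_
      · intro q hq
        obtain ⟨x, hx, rfl⟩ := mem_image.mp hq
        obtain ⟨h1, h2⟩ := mem_product.mp hx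
        exact mem_product.mpr ⟨mem_image_of_mem _ h1, h2⟩
      · intro q hq
        obtain ⟨x, hx, rfl⟩ := mem_image.mp hq
        obtain ⟨h1, h2⟩ := mem_product.mp hx
        obtain ⟨h2, h3⟩ := mem_product.mp h2
        exact mem_product.mpr ⟨h1, mem_product.mpr ⟨h2, mem_image_of_mem _ h3⟩⟩
    have h2 := card_le_card (filter_subset_filter (InNullQuadric t) h1)
    rw [filter_union _ ((Γ.image (ξ * ·)) ×ˢ A ×ˢ A)] at h2
    have h3 := h2.trans (card_union_le _ _)
    have h4 := card_filter_inNullQuadric_le (Γ.image (ξ * ·)) A A ht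
    have h5 := card_filter_inNullQuadric_le Γ A (A.image (ξ⁻¹ * ·)) ht
    have h6 : #(Γ.image (ξ * ·)) ≤ #Γ := card_image_le
    have h7 : #(A.image (ξ⁻¹ * ·)) ≤ #A := card_image_le
    omega
  have hchar : ∀ m : ℕ, 0 < m → 4 * m ^ 2 ≤ #L → (m : ZMod p) ≠ 0 := by
    intro m hm hmL h0
    have hdvd := (ZMod.natCast_eq_zero_iff m p).mp h0
    have := Nat.pow_le_pow_left (Nat.le_of_dvd hm hdvd) 2
    have := pow_pos (Fact.out : p.Prime).pos 2
    omega
  have hrich := card_richPoints_le _ L hquad hchar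
  have hLr : (#L : ℝ) ≤ 2 * #Γ * #A ^ 2 := by
    rw [mul_assoc]
    exact_mod_cast hLcard
  have hmain' : (#Γ : ℝ) ^ 2 * dilatedEnergy 1 A ≤
      #(richPoints L) + #Γ ^ 2 * dilatedEnergy ξ A + #Γ ^ 2 * dilatedEnergy ξ A := by
    exact_mod_cast hmain
  have hfin : (#(richPoints L) : ℝ) ≤ 2 ^ 22 * ((2 * #Γ * #A ^ 2) * √(2 * #Γ * #A ^ 2)) +
      (4 * #Γ + 4 * #A + 2 * #A) * (2 * #Γ * #A ^ 2) := by
    refine hrich.trans ?_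
    push_cast
    gcongr
  linarith

/-- The additive energy of a set invariant under multiplication by a subgroup `Γ`. -/
theorem dilatedEnergy_one_le (hΓ0 : 0 ∉ Γ) (hΓ1 : 1 ∈ Γ)
    (hΓmul : ∀ x ∈ Γ, ∀ y ∈ Γ, x * y ∈ Γ) (hΓinv : ∀ x ∈ Γ, x⁻¹ ∈ Γ)
    (hA : ∀ g ∈ Γ, ∀ a ∈ A, g * a ∈ A) (hA0 : 0 ∉ A) :
    (dilatedEnergy 1 A : ℝ) ≤ 2 ^ 24 * (#A ^ 4 / p + #A ^ 3 / √(#Γ)) := by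
  have hp : (0 : ℝ) < p := by exact_mod_cast (Fact.out : p.Prime).pos
  have ht : (0 : ℝ) < #Γ := by exact_mod_cast card_pos.mpr ⟨1, hΓ1⟩
  have ht1 : (1 : ℝ) ≤ #Γ := by exact_mod_cast card_pos.mpr ⟨1, hΓ1⟩
  rcases A.eq_empty_or_nonempty with rfl | ⟨a₀, ha₀⟩
  · simp [dilatedEnergy]
  have htA : (#Γ : ℝ) ≤ #A := by
    have ha : a₀ ≠ 0 := fun h => hA0 (h ▸ ha₀)
    exact_mod_cast card_le_card_of_injOn (· * a₀) (fun g hg => hA g hg a₀ ha₀)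
      (fun x _ y _ h => mul_right_cancel₀ ha h)
  set a : ℝ := (#A : ℝ) with ha
  set t : ℝ := (#Γ : ℝ) with htdef
  set s := √t with hs
  have hs2 : s ^ 2 = t := Real.sq_sqrt ht.le
  have hs0 : 0 < s := Real.sqrt_pos.mpr ht
  have hs1 : 1 ≤ s := Real.one_le_sqrt.mpr ht1
  have hsa : s ≤ a := by nlinarith
  have ha0 : 0 < a := by linarith
  have hX : 0 ≤ a ^ 4 / p := by positivity
  have hY : 0 ≤ a ^ 3 / s := by positivity
  have ha2 : a ^ 2 ≤ a ^ 3 / s := by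
    rw [le_div_iff₀ hs0]
    calc a ^ 2 * s ≤ a ^ 2 * a := by gcongr
      _ = a ^ 3 := by ring
  by_cases hbig : p ^ 2 < #Γ * #A ^ 2
  · have h1 := card_mul_dilatedEnergy_le hΓ0 hΓinv hA
    have hbig' : (p : ℝ) ^ 2 < t * a ^ 2 := by
      rw [htdef, ha]
      exact_mod_cast hbig
    have hpsa : (p : ℝ) ≤ s * a := by
      refine le_of_sq_le_sq ?_ (by positivity)
      rw [mul_pow, hs2]
      exact hbig'.le
    have h2 : (p : ℝ) * a ^ 2 ≤ t * (a ^ 3 / s) := by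
      have : t * (a ^ 3 / s) = s * a * a ^ 2 := by
        rw [← hs2]
        field_simp
      rw [this]
      gcongr
    have h3 : (1 + t) * (a ^ 4 / p) ≤ t * (2 * (a ^ 4 / p)) := by nlinarith
    have h4 : t * (dilatedEnergy 1 A : ℝ) ≤ t * (a ^ 3 / s + 2 * (a ^ 4 / p)) := by
      calc t * (dilatedEnergy 1 A : ℝ) ≤ p * a ^ 2 + (1 + t) * (a ^ 4 / p) := h1
        _ ≤ _ := by rw [mul_add]; exact add_le_add h2 h3
    have h5 := le_of_mul_le_mul_left h4 ht
    linarith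
  · obtain ⟨ξ, hξ0, hξ⟩ := exists_dilatedEnergy_le A
    by_cases hmem : ξ ∈ Γ
    · rw [dilatedEnergy_of_mem hΓ0 hΓinv hA hmem] at hξ
      change (dilatedEnergy 1 A : ℝ) ≤ a ^ 2 + 2 * (a ^ 4 / p) at hξ
      linarith
    · have h1 := card_sq_mul_dilatedEnergy_le hΓ0 hΓmul hΓinv hA hξ0 hmem (not_lt.mp hbig)
      change t ^ 2 * (dilatedEnergy 1 A : ℝ) ≤ 2 ^ 22 * ((2 * t * a ^ 2) * √(2 * t * a ^ 2)) +
        (4 * t + 4 * a + 2 * a) * (2 * t * a ^ 2) + 2 * (t ^ 2 * dilatedEnergy ξ A) at h1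
      change (dilatedEnergy ξ A : ℝ) ≤ a ^ 2 + 2 * (a ^ 4 / p) at hξ
      have hsqrt : √(2 * t * a ^ 2) ≤ 3 / 2 * (s * a) := by
        rw [Real.sqrt_le_left (by positivity)]
        have : (3 / 2 * (s * a)) ^ 2 = 9 / 4 * t * a ^ 2 := by rw [← hs2]; ring
        rw [this]
        gcongr
        norm_num
      have h2 : (2 * t * a ^ 2) * √(2 * t * a ^ 2) ≤ t ^ 2 * (3 * (a ^ 3 / s)) := by
        calc (2 * t * a ^ 2) * √(2 * t * a ^ 2) ≤ (2 * t * a ^ 2) * (3 / 2 * (s * a)) := by gcongr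
          _ = _ := by
            rw [← hs2]
            field_simp
      have h3 : (4 * t + 4 * a + 2 * a) * (2 * t * a ^ 2) ≤ t ^ 2 * (20 * (a ^ 3 / s)) := by
        calc (4 * t + 4 * a + 2 * a) * (2 * t * a ^ 2) ≤
              (4 * a + 4 * a + 2 * a) * (2 * t * a ^ 2) := by gcongr
          _ = 20 * t * a ^ 3 * 1 := by ring
          _ ≤ 20 * t * a ^ 3 * s := by gcongr
          _ = _ := by
            rw [← hs2]
            field_simp
      have h4 : t ^ 2 * (dilatedEnergy ξ A : ℝ) ≤ t ^ 2 * (a ^ 3 / s + 2 * (a ^ 4 / p)) := by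
        gcongr
        linarith
      have h5 : t ^ 2 * (dilatedEnergy 1 A : ℝ) ≤
          t ^ 2 * (2 ^ 22 * (3 * (a ^ 3 / s)) + 20 * (a ^ 3 / s) +
            2 * (a ^ 3 / s + 2 * (a ^ 4 / p))) := by
        nlinarith
      have h6 := le_of_mul_le_mul_left h5 (by positivity)
      linarith

end InvariantEnergy

section Convolution

variable {G : Type*} [AddCommGroup G] [Fintype G]

/-- Additive convolution of real functions on a finite group. -/
def addConv (g h : G → ℝ) (x : G) : ℝ := ∑ y, g y * h (x - y)

/-- The autocorrelation of a real function on a finite group. -/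
def autocorr (g : G → ℝ) (u : G) : ℝ := ∑ c, g (c + u) * g c

/-- The additive energy of a real function on a finite group. -/
def fnEnergy (g : G → ℝ) : ℝ := ∑ x, addConv g g x ^ 2

lemma sum_addConv_sq (g h : G → ℝ) :
    ∑ x, addConv g h x ^ 2 = ∑ u, autocorr g u * autocorr h u := by
  have hl : ∑ x, addConv g h x ^ 2 = ∑ z, ∑ y, ∑ x, g y * h (x - y) * (g z * h (x - z)) := by
    simp_rw [sq, addConv, sum_mul_sum]
    rw [sum_comm]
    refine (sum_congr rfl fun y _ => sum_comm).trans sum_comm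
  have hr : ∑ u, autocorr g u * autocorr h u =
      ∑ c, ∑ u, ∑ d, g (c + u) * g c * (h (d + u) * h d) := by
    simp_rw [autocorr, sum_mul_sum]
    exact sum_comm
  rw [hl, hr]
  refine sum_congr rfl fun z _ => ?_
  rw [← Equiv.sum_comp (Equiv.addLeft z)]
  refine sum_congr rfl fun u _ => ?_
  rw [← Equiv.sum_comp (Equiv.addLeft (z + u))]
  refine sum_congr rfl fun d _ => ?_
  simp only [Equiv.coe_addLeft]
  have e1 : z + u + d - (z + u) = d := by abel
  have e2 : z + u + d - z = d + u := by abel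
  rw [e1, e2]
  ring

lemma fnEnergy_sum_le {ι : Type*} (I : Finset ι) (g : ι → G → ℝ) :
    fnEnergy (fun x => ∑ i ∈ I, g i x) ≤ #I ^ 3 * ∑ i ∈ I, fnEnergy (g i) := by
  have hconv : ∀ x, addConv (fun x => ∑ i ∈ I, g i x) (fun x => ∑ i ∈ I, g i x) x =
      ∑ z ∈ I ×ˢ I, addConv (g z.1) (g z.2) x := by
    intro x
    simp only [addConv, sum_product, sum_mul_sum]
    rw [sum_comm]
    exact sum_congr rfl fun i _ => sum_comm
  calc fnEnergy (fun x => ∑ i ∈ I, g i x)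
      = ∑ x, (∑ z ∈ I ×ˢ I, addConv (g z.1) (g z.2) x) ^ 2 := by
        simp_rw [fnEnergy, hconv]
    _ ≤ ∑ x, (#(I ×ˢ I) : ℝ) * ∑ z ∈ I ×ˢ I, addConv (g z.1) (g z.2) x ^ 2 :=
        sum_le_sum fun x _ => sq_sum_le_card_mul_sum_sq
    _ = #I ^ 2 * ∑ u, (∑ i ∈ I, autocorr (g i) u) ^ 2 := by
        rw [← mul_sum, sum_comm, card_product, Nat.cast_mul, ← sq]
        simp_rw [sum_addConv_sq]
        rw [sum_comm]
        simp_rw [sq (∑ i ∈ I, autocorr (g i) _), sum_mul_sum, sum_product]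
    _ ≤ #I ^ 2 * ∑ u, (#I : ℝ) * ∑ i ∈ I, autocorr (g i) u ^ 2 := by
        gcongr
        exact sq_sum_le_card_mul_sum_sq
    _ = _ := by
        rw [← mul_sum, sum_comm]
        simp_rw [fnEnergy, sum_addConv_sq, ← sq]
        ring

lemma fnEnergy_mono {g h : G → ℝ} (hg : ∀ x, 0 ≤ g x) (hgh : ∀ x, g x ≤ h x) :
    fnEnergy g ≤ fnEnergy h := by
  unfold fnEnergy addConv
  have hh : ∀ x, 0 ≤ h x := fun x => (hg x).trans (hgh x)
  gcongr with x _ y _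
  · exact sum_nonneg fun y _ => mul_nonneg (hg _) (hg _)
  · exact hg _
  · exact hh _
  · exact hgh _
  · exact hgh _

lemma fnEnergy_const_mul (c : ℝ) (g : G → ℝ) :
    fnEnergy (fun x => c * g x) = c ^ 4 * fnEnergy g := by
  rw [fnEnergy, fnEnergy, mul_sum]
  refine sum_congr rfl fun x _ => ?_
  have : addConv (fun x => c * g x) (fun x => c * g x) x = c ^ 2 * addConv g g x := by
    rw [addConv, addConv, mul_sum]
    exact sum_congr rfl fun y _ => by ring
  rw [this]
  ring

end Convolution

section DyadicDecomposition

lemma fnEnergy_indicator {K : Type*} [Field K] [DecidableEq K] [Fintype K] (A : Finset K) :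
    fnEnergy (fun x => if x ∈ A then (1 : ℝ) else 0) = dilatedEnergy 1 A := by
  rw [fnEnergy, dilatedEnergy_eq_sum_sq]
  push_cast
  refine sum_congr rfl fun x _ => ?_
  congr 1
  have : #((A ×ˢ A).filter fun z => z.1 + 1 * z.2 = x) = #(A.filter fun y => x - y ∈ A) := by
    refine card_nbij' Prod.fst (fun y => (y, x - y)) ?_ ?_ ?_ ?_
    · rintro ⟨a, b⟩ h
      simp only [coe_filter, mem_product, Set.mem_ofPred_eq, one_mul] at h ⊢
      obtain ⟨⟨ha, hb⟩, rfl⟩ := h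
      exact ⟨ha, by simpa using hb⟩
    · intro y h
      simp only [coe_filter, mem_product, Set.mem_ofPred_eq, one_mul] at h ⊢
      exact ⟨h, by ring⟩
    · rintro ⟨a, b⟩ h
      simp only [coe_filter, mem_product, Set.mem_ofPred_eq, one_mul] at h ⊢
      obtain ⟨⟨ha, hb⟩, rfl⟩ := h
      simp
    · intro y _
      rfl
  rw [this, addConv, card_filter]
  push_cast
  simp only [ite_mul, one_mul, zero_mul]
  rw [← sum_filter, filter_mem_eq_inter, univ_inter]

lemma fnEnergy_restrict_le {K : Type*} [Field K] [DecidableEq K] [Fintype K] (A : Finset K)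
    (f : K → ℝ) (hf : ∀ x, 0 ≤ f x) (w : ℝ) (hw : ∀ x ∈ A, f x ≤ w) :
    fnEnergy (fun x => if x ∈ A then f x else 0) ≤ w ^ 4 * dilatedEnergy 1 A := by
  rw [← fnEnergy_indicator, ← fnEnergy_const_mul]
  refine fnEnergy_mono (fun x => ?_) (fun x => ?_)
  · split_ifs
    · exact hf x
    · exact le_rfl
  · split_ifs with h
    · simpa using hw x h
    · simp

variable {p : ℕ} [Fact p.Prime] {Γ : Finset (ZMod p)}

lemma fnEnergy_level_le (hΓ0 : 0 ∉ Γ) (hΓ1 : 1 ∈ Γ)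
    (hΓmul : ∀ x ∈ Γ, ∀ y ∈ Γ, x * y ∈ Γ) (hΓinv : ∀ x ∈ Γ, x⁻¹ ∈ Γ)
    (f : ZMod p → ℕ) {A : Finset (ZMod p)} (hA : ∀ g ∈ Γ, ∀ a ∈ A, g * a ∈ A) (hA0 : 0 ∉ A) {w : ℝ}
    (hw0 : 0 ≤ w) (hw : ∀ x ∈ A, w ≤ f x ∧ (f x : ℝ) ≤ 2 * w) :
    fnEnergy (fun x => if x ∈ A then (f x : ℝ) else 0) ≤ 2 ^ 28 *
      ((∑ x, (f x : ℝ)) ^ 4 / p + (∑ x, (f x : ℝ)) ^ 2 * (∑ x, (f x : ℝ) ^ 2) / √(#Γ)) := by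
  have hE := dilatedEnergy_one_le hΓ0 hΓ1 hΓmul hΓinv hA hA0
  have h1 := fnEnergy_restrict_le A (fun x => (f x : ℝ)) (fun x => Nat.cast_nonneg _)
    (2 * w) (fun x hx => (hw x hx).2)
  have hS : w * #A ≤ ∑ x, (f x : ℝ) := by
    rw [mul_comm, ← nsmul_eq_mul]
    exact (card_nsmul_le_sum _ (fun x => (f x : ℝ)) _ fun x hx => (hw x hx).1).trans
      (sum_le_univ_sum_of_nonneg fun _ => Nat.cast_nonneg _)
  have hT : w ^ 2 * #A ≤ ∑ x, (f x : ℝ) ^ 2 := by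
    rw [mul_comm, ← nsmul_eq_mul]
    refine (card_nsmul_le_sum _ (fun x => (f x : ℝ) ^ 2) _ fun x hx => ?_).trans
      (sum_le_univ_sum_of_nonneg fun _ => by positivity)
    have := (hw x hx).1
    gcongr
  generalize ∑ x, (f x : ℝ) = S at *
  generalize ∑ x, (f x : ℝ) ^ 2 = T at *
  calc _ ≤ (2 * w) ^ 4 * (dilatedEnergy 1 A : ℝ) := h1
    _ ≤ (2 * w) ^ 4 * (2 ^ 24 * (#A ^ 4 / p + #A ^ 3 / √(#Γ))) := by gcongr
    _ = 2 ^ 28 * ((w * #A) ^ 4 / p + (w * #A) ^ 2 * (w ^ 2 * #A) / √(#Γ)) := by ring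
    _ ≤ _ := by gcongr

lemma fnEnergy_zero_le (hΓ1 : 1 ∈ Γ) (f : ZMod p → ℕ) {A : Finset (ZMod p)} (hA : A ⊆ {0})
    (hS : f 0 * #Γ ≤ ∑ x, f x) :
    fnEnergy (fun x => if x ∈ A then (f x : ℝ) else 0) ≤ 2 ^ 28 *
      ((∑ x, (f x : ℝ)) ^ 4 / p + (∑ x, (f x : ℝ)) ^ 2 * (∑ x, (f x : ℝ) ^ 2) / √(#Γ)) := by
  have ht1 : (1 : ℝ) ≤ #Γ := by exact_mod_cast card_pos.mpr ⟨1, hΓ1⟩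
  have hs1 : 1 ≤ √(#Γ : ℝ) := Real.one_le_sqrt.mpr ht1
  have hs2 : √(#Γ : ℝ) ^ 2 = #Γ := Real.sq_sqrt (by linarith)
  have h1 := fnEnergy_restrict_le A (fun x => (f x : ℝ)) (fun x => Nat.cast_nonneg _) (f 0)
    (fun x hx => by rw [mem_singleton.mp (hA hx)])
  have h2 : dilatedEnergy 1 A ≤ 1 := by
    refine (card_filter_le _ _).trans ?_
    simp only [card_product]
    have := card_le_card hA
    rw [card_singleton] at this
    calc _ ≤ 1 * 1 * (1 * 1) := by gcongr
      _ = 1 := rfl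
  have h3 : (dilatedEnergy 1 A : ℝ) ≤ 1 := by exact_mod_cast h2
  have h4 : (f 0 : ℝ) ^ 2 ≤ ∑ x, (f x : ℝ) ^ 2 :=
    single_le_sum (f := fun x => (f x : ℝ) ^ 2) (fun _ _ => by positivity) (mem_univ 0)
  have h5 : (f 0 : ℝ) * #Γ ≤ ∑ x, (f x : ℝ) := by exact_mod_cast hS
  generalize ∑ x, (f x : ℝ) = S at *
  generalize ∑ x, (f x : ℝ) ^ 2 = T at *
  rw [← hs2] at h5
  generalize √(#Γ : ℝ) = s at *
  have hs0 : 0 < s := by linarith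
  have hf0 : (0 : ℝ) ≤ f 0 := Nat.cast_nonneg _
  have hS0 : 0 ≤ S := le_trans (by positivity) h5
  have hT0 : 0 ≤ T := le_trans (by positivity) h4
  have h6 : (f 0 : ℝ) ≤ S / s := by
    rw [le_div_iff₀ hs0]
    calc (f 0 : ℝ) * s ≤ f 0 * s ^ 2 := by
          gcongr
          nlinarith
      _ ≤ S := h5
  calc _ ≤ (f 0 : ℝ) ^ 4 * dilatedEnergy 1 A := h1
    _ ≤ (f 0 : ℝ) ^ 4 * 1 := by gcongr
    _ = (f 0 : ℝ) ^ 2 * (f 0 : ℝ) ^ 2 := by ring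
    _ ≤ (S / s) ^ 2 * T := by gcongr
    _ = S ^ 2 * T / s / s := by field_simp
    _ ≤ S ^ 2 * T / s := div_le_self (by positivity) hs1
    _ ≤ _ := by
      have : 0 ≤ S ^ 2 * T / s := by positivity
      have : 0 ≤ S ^ 4 / p := by positivity
      linarith

/-- The additive energy of a `Γ`-invariant function, in terms of its first two moments. -/
theorem fnEnergy_le_of_invariant (hΓ0 : 0 ∉ Γ) (hΓ1 : 1 ∈ Γ)
    (hΓmul : ∀ x ∈ Γ, ∀ y ∈ Γ, x * y ∈ Γ) (hΓinv : ∀ x ∈ Γ, x⁻¹ ∈ Γ)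
    (f : ZMod p → ℕ) (hf : ∀ g ∈ Γ, ∀ x, f (g * x) = f x) {Q : ℕ} (hQ : ∀ x, f x ≤ Q)
    (hQS : f 0 * #Γ ≤ ∑ x, f x) :
    fnEnergy (fun x => (f x : ℝ)) ≤ ((Nat.log 2 Q + 2 : ℕ) : ℝ) ^ 4 * (2 ^ 28 *
      ((∑ x, (f x : ℝ)) ^ 4 / p + (∑ x, (f x : ℝ)) ^ 2 * (∑ x, (f x : ℝ) ^ 2) / √(#Γ))) := by
  set J := Nat.log 2 Q + 1 with hJ
  let idx : ZMod p → ℕ := fun x => if x = 0 then J else Nat.log 2 (f x)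
  let A : ℕ → Finset (ZMod p) := fun i => univ.filter fun x => f x ≠ 0 ∧ idx x = i
  have hdecomp : (fun x => (f x : ℝ)) =
      fun x => ∑ i ∈ range (J + 1), if x ∈ A i then (f x : ℝ) else 0 := by
    funext x
    have hidx : idx x ∈ range (J + 1) := by
      rw [mem_range]
      simp only [idx]
      split_ifs
      · omega
      · have := Nat.log_mono_right (b := 2) (hQ x)
        omega
    by_cases h0 : f x = 0
    · simp [h0]
    · rw [sum_eq_single_of_mem _ hidx]
      · simp [A, h0]
      · intro i _ hi
        simp [A, hi.symm]
  have hpiece : ∀ i ∈ range (J + 1), fnEnergy (fun x => if x ∈ A i then (f x : ℝ) else 0) ≤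
      2 ^ 28 * ((∑ x, (f x : ℝ)) ^ 4 / p +
        (∑ x, (f x : ℝ)) ^ 2 * (∑ x, (f x : ℝ) ^ 2) / √(#Γ)) := by
    intro i hi
    by_cases hiJ : i = J
    · refine fnEnergy_zero_le hΓ1 f (fun x hx => ?_) hQS
      rw [mem_singleton]
      by_contra hx0
      have h2 := (mem_filter.mp hx).2.2
      simp only [idx, if_neg hx0] at h2
      have := Nat.log_mono_right (b := 2) (hQ x)
      omega
    · have hmem : ∀ x ∈ A i, x ≠ 0 ∧ 2 ^ i ≤ f x ∧ f x < 2 ^ (i + 1) := by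
        intro x hx
        obtain ⟨-, hx1, hx2⟩ := mem_filter.mp hx
        have hx0 : x ≠ 0 := by
          rintro rfl
          simp only [idx, if_true] at hx2
          exact hiJ hx2.symm
        simp only [idx, if_neg hx0] at hx2
        exact ⟨hx0, (Nat.log_eq_iff (Or.inr ⟨one_lt_two, hx1⟩)).mp hx2⟩
      refine fnEnergy_level_le hΓ0 hΓ1 hΓmul hΓinv f (w := 2 ^ i) (fun g hg a ha => ?_)
        (fun h => (hmem 0 h).1 rfl) (by positivity) (fun x hx => ?_)
      · have hg0 : g ≠ 0 := fun h => hΓ0 (h ▸ hg)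
        obtain ⟨-, h1, h2⟩ := mem_filter.mp ha
        refine mem_filter.mpr ⟨mem_univ _, by rwa [hf g hg], ?_⟩
        simpa only [idx, hf g hg, mul_eq_zero, hg0, false_or] using h2
      · obtain ⟨-, h1, h2⟩ := hmem x hx
        rw [← pow_succ']
        exact ⟨by exact_mod_cast h1, by exact_mod_cast h2.le⟩
  have hJ' : Nat.log 2 Q + 2 = J + 1 := rfl
  rw [hJ']
  refine ((congrArg fnEnergy hdecomp).le.trans (fnEnergy_sum_le _ _)).trans ?_
  have h := sum_le_card_nsmul _ _ _ hpiece
  rw [card_range, nsmul_eq_mul] at h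
  rw [card_range, pow_succ _ 3, mul_assoc]
  exact mul_le_mul_of_nonneg_left h (by positivity)

end DyadicDecomposition

section Representations

variable {K : Type*} [AddCommGroup K] [DecidableEq K]

/-- The number of representations of `x` as an ordered sum of `m` elements of `A`. -/
def repCount (m : ℕ) (A : Finset K) (x : K) : ℕ :=
  #((Fintype.piFinset fun _ : Fin m => A).filter fun v => ∑ i, v i = x)

lemma repCount_one_le (A : Finset K) (x : K) : repCount 1 A x ≤ 1 := by
  refine card_le_one.mpr fun v hv w hw => ?_
  have hv := (mem_filter.mp hv).2
  have hw := (mem_filter.mp hw).2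
  simp only [Fin.sum_univ_one] at hv hw
  funext i
  rw [Subsingleton.elim i 0, hv, hw]

lemma Tplus_two (A : Finset K) : Tplus 2 A = Eplus A := by
  refine card_equiv (((finTwoArrowEquiv K).prodCongr (finTwoArrowEquiv K)).trans
    (Equiv.prodAssoc K K (K × K))) fun z => ?_
  simp [Fin.forall_fin_two, and_assoc]

variable [Fintype K]

lemma sum_repCount (m : ℕ) (A : Finset K) : ∑ x, repCount m A x = #A ^ m := by
  have h := card_eq_sum_card_fiberwise (s := Fintype.piFinset fun _ : Fin m => A)
    (f := fun v => ∑ i, v i) (t := univ) (fun _ _ => mem_coe.mpr (mem_univ _))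
  rw [Fintype.card_piFinset, prod_const, card_univ, Fintype.card_fin] at h
  exact h.symm

lemma Tplus_eq_sum_sq (m : ℕ) (A : Finset K) : Tplus m A = ∑ x, repCount m A x ^ 2 :=
  card_filter_eq_eq_sum_sq _ fun v : Fin m → K => ∑ i, v i

lemma repCount_add (m n : ℕ) (A : Finset K) (x : K) :
    repCount (m + n) A x = ∑ y, repCount m A y * repCount n A (x - y) := by
  let S := ((Fintype.piFinset fun _ : Fin m => A) ×ˢ (Fintype.piFinset fun _ : Fin n => A)).filter
    fun z => ∑ i, z.1 i + ∑ i, z.2 i = x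
  have hS : repCount (m + n) A x = #S := by
    symm
    refine card_equiv (Fin.appendEquiv m n) fun z => ?_
    simp [S, Fin.appendEquiv, Fin.sum_univ_add, Fin.forall_fin_add]
  rw [hS, card_eq_sum_card_fiberwise (f := fun z => ∑ i, z.1 i) (t := univ)
    (fun _ _ => mem_coe.mpr (mem_univ _))]
  refine sum_congr rfl fun y _ => ?_
  rw [repCount, repCount, ← card_product]
  congr 1
  ext z
  simp only [S, mem_filter, mem_product]
  constructor
  · rintro ⟨⟨⟨h1, h2⟩, h3⟩, h4⟩
    exact ⟨⟨h1, h4⟩, h2, by rw [← h4, ← h3]; abel⟩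
  · rintro ⟨⟨h1, h4⟩, h2, h3⟩
    exact ⟨⟨⟨h1, h2⟩, by rw [h3, h4]; abel⟩, h4⟩

lemma repCount_succ_le (m : ℕ) (A : Finset K) (x : K) : repCount (m + 1) A x ≤ #A ^ m := by
  rw [repCount_add, ← sum_repCount]
  exact sum_le_sum fun y _ => (Nat.mul_le_mul_left _ (repCount_one_le A _)).trans_eq (mul_one _)

lemma Tplus_add_self (m : ℕ) (A : Finset K) :
    (Tplus (m + m) A : ℝ) = fnEnergy fun x => (repCount m A x : ℝ) := by
  rw [Tplus_eq_sum_sq, fnEnergy]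
  push_cast
  simp_rw [repCount_add, addConv]
  push_cast
  rfl

end Representations

section Subgroup

lemma repCount_mul_left {K : Type*} [Field K] [Fintype K] [DecidableEq K] {Γ : Finset K}
    (hΓ : IsMulSubgroup Γ) (m : ℕ) {g : K} (hg : g ∈ Γ) (x : K) :
    repCount m Γ (g * x) = repCount m Γ x := by
  have hg0 : g ≠ 0 := fun h => hΓ.1 (h ▸ hg)
  symm
  refine card_equiv (Equiv.piCongrRight fun _ => Equiv.mulLeft₀ g hg0) fun v => ?_
  have hmem : ∀ a, g * a ∈ Γ ↔ a ∈ Γ := fun a =>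
    ⟨fun h => by simpa [hg0] using hΓ.2.2.1 _ (hΓ.2.2.2 g hg) _ h, hΓ.2.2.1 g hg a⟩
  simp [hmem, ← mul_sum, hg0]

variable {p : ℕ} [Fact p.Prime] {Γ : Finset (ZMod p)}

lemma log_card_pow_add_two_le {t m : ℕ} (ht : 4 ≤ t) :
    ((Nat.log 2 (t ^ m) + 2 : ℕ) : ℝ) ≤ (m + 1 : ℕ) * Real.logb 2 t := by
  have h4 : 2 ≤ Real.logb 2 t := by
    rw [Real.le_logb_iff_rpow_le one_lt_two (by positivity)]
    norm_num
    exact_mod_cast ht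
  have h := Real.natLog_le_logb (t ^ m) 2
  push_cast [Real.logb_pow] at h ⊢
  linarith

theorem Tplus_double_le (hΓ : IsMulSubgroup Γ) (hcard : 4 ≤ #Γ) {m : ℕ} (hm : 1 ≤ m) :
    (Tplus (m + m) Γ : ℝ) ≤ (m * Real.logb 2 #Γ) ^ 4 * (2 ^ 28 *
      ((#Γ : ℝ) ^ (4 * m) / p + (#Γ : ℝ) ^ (2 * m) * Tplus m Γ / √(#Γ))) := by
  obtain ⟨n, rfl⟩ := Nat.exists_eq_add_of_le' hm
  have h := fnEnergy_le_of_invariant hΓ.1 hΓ.2.1 hΓ.2.2.1 hΓ.2.2.2 (repCount (n + 1) Γ)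
    (fun g hg x => repCount_mul_left hΓ _ hg x) (repCount_succ_le n Γ) (by
      rw [sum_repCount, pow_succ]
      exact Nat.mul_le_mul_right _ (repCount_succ_le n Γ 0))
  rw [Tplus_add_self]
  refine h.trans ?_
  have hsum : (∑ x, (repCount (n + 1) Γ x : ℝ)) = (#Γ : ℝ) ^ (n + 1) := by
    exact_mod_cast sum_repCount (n + 1) Γ
  have hsq : (∑ x, (repCount (n + 1) Γ x : ℝ) ^ 2) = Tplus (n + 1) Γ := by
    exact_mod_cast (Tplus_eq_sum_sq (n + 1) Γ).symm
  rw [hsum, hsq, ← pow_mul, ← pow_mul, mul_comm (n + 1) 4, mul_comm (n + 1) 2]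
  have hl := log_card_pow_add_two_le (m := n) hcard
  gcongr

end Subgroup

section Iteration

lemma logb_two_pow_sixteen_le {t : ℝ} (ht : 2 ^ 192 ≤ t) : Real.logb 2 t ^ 16 ≤ t := by
  have ht1 : 1 ≤ t := le_trans (by norm_num) ht
  have ht0 : 0 ≤ t := by linarith
  have hlog := Real.log_le_rpow_div ht0 (ε := 1 / 32) (by norm_num)
  have hl2 : 1 / 2 ≤ Real.log 2 := by linarith [Real.log_two_gt_d9]
  have hrp : 0 ≤ t ^ (1 / 32 : ℝ) := by positivity
  have h1 : Real.logb 2 t ≤ 64 * t ^ (1 / 32 : ℝ) := by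
    rw [Real.logb, div_le_iff₀ (by linarith)]
    nlinarith
  have h2 : (t ^ (1 / 32 : ℝ)) ^ 16 = √t := by
    rw [← Real.rpow_natCast, ← Real.rpow_mul ht0, Real.sqrt_eq_rpow]
    norm_num
  have h3 : 2 ^ 96 ≤ √t := Real.le_sqrt_of_sq_le (by linarith)
  calc Real.logb 2 t ^ 16 ≤ (64 * t ^ (1 / 32 : ℝ)) ^ 16 :=
        pow_le_pow_left₀ (Real.logb_nonneg one_lt_two ht1) h1 _
    _ = 2 ^ 96 * √t := by rw [mul_pow, h2]; norm_num
    _ ≤ √t * √t := by gcongr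
    _ = t := Real.mul_self_sqrt ht0

lemma mul_logb_pow_four_le_sqrt {t : ℝ} (j : ℕ)
    (ht : 2 ^ (64 * (j + 2)) * (2 ^ 28) ^ 4 ≤ t) :
    2 ^ (4 * j + 10) * 2 ^ 28 * Real.logb 2 t ^ 4 ≤ √t := by
  have hbig : (2 : ℝ) ^ 192 ≤ t := by
    refine le_trans ?_ ht
    have h1 : (2 : ℝ) ^ 128 ≤ 2 ^ (64 * (j + 2)) := pow_le_pow_right₀ one_le_two (by omega)
    calc (2 : ℝ) ^ 192 ≤ 2 ^ 128 * (2 ^ 28) ^ 4 := by norm_num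
      _ ≤ _ := by gcongr
  have ht0 : 0 ≤ t := le_trans (by positivity) hbig
  have hpow : (2 : ℝ) ^ (4 * (4 * j + 10)) ≤ 2 ^ (64 * (j + 2)) :=
    pow_le_pow_right₀ one_le_two (by omega)
  have hlog := logb_two_pow_sixteen_le hbig
  refine le_of_pow_le_pow_left₀ four_ne_zero (Real.sqrt_nonneg t) ?_
  calc (2 ^ (4 * j + 10) * 2 ^ 28 * Real.logb 2 t ^ 4) ^ 4
      = 2 ^ (4 * (4 * j + 10)) * (2 ^ 28) ^ 4 * Real.logb 2 t ^ 16 := by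
        rw [mul_comm 4 (4 * j + 10), pow_mul]
        ring
    _ ≤ 2 ^ (64 * (j + 2)) * (2 ^ 28) ^ 4 * t := by gcongr
    _ ≤ t * t := by gcongr
    _ = √t ^ 4 := by
        rw [show 4 = 2 * 2 from rfl, pow_mul, Real.sq_sqrt ht0, sq]

variable {p : ℕ} [Fact p.Prime] {Γ : Finset (ZMod p)}

theorem Tplus_two_pow_le (hΓ : IsMulSubgroup Γ) (j : ℕ)
    (hcard : (2 : ℝ) ^ (64 * (j + 1)) * (2 ^ 28) ^ 4 ≤ #Γ) :
    (Tplus (2 ^ (j + 1)) Γ : ℝ) ≤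
      2 ^ (4 * (j + 1) + 6) * 2 ^ 28 * Real.logb 2 #Γ ^ 4 * (#Γ : ℝ) ^ (2 ^ (j + 2)) / p +
      16 ^ ((j + 1) ^ 2) * (2 ^ 28) ^ j * Real.logb 2 #Γ ^ (4 * j) *
        (#Γ : ℝ) ^ ((2 : ℝ) ^ (j + 2) - (j + 8) / 2) * (Eplus Γ : ℝ) := by
  have h4 : (4 : ℝ) ≤ #Γ := by
    refine le_trans ?_ hcard
    have : (1 : ℝ) ≤ 2 ^ (64 * (j + 1)) := one_le_pow₀ one_le_two
    linarith
  have ht0 : (0 : ℝ) < #Γ := by linarith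
  have hl0 : 0 ≤ Real.logb 2 #Γ := Real.logb_nonneg one_lt_two (by linarith)
  induction j with
  | zero =>
    rw [zero_add, pow_one, Tplus_two]
    have hE : (0 : ℝ) ≤ Eplus Γ := Nat.cast_nonneg _
    have hmain : 0 ≤ 2 ^ (4 * 1 + 6) * 2 ^ 28 * Real.logb 2 #Γ ^ 4 *
      (#Γ : ℝ) ^ (2 ^ (0 + 2)) / p := by positivity
    norm_num at hmain ⊢
    linarith
  | succ j ih =>
    have ih := ih (le_trans (mul_le_mul_of_nonneg_right
      (pow_le_pow_right₀ one_le_two (by omega)) (by positivity)) hcard)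
    have hsqrt := mul_logb_pow_four_le_sqrt j hcard
    have hs0 : 0 < √(#Γ : ℝ) := Real.sqrt_pos.mpr ht0
    have hstep := Tplus_double_le hΓ (by exact_mod_cast h4) (Nat.one_le_two_pow (n := j + 1))
    rw [← two_mul, ← pow_succ', show 4 * 2 ^ (j + 1) = 2 ^ (j + 3) by ring] at hstep
    push_cast at hstep ⊢
    set t : ℝ := (#Γ : ℝ)
    set l := Real.logb 2 t
    set M := t ^ 2 ^ (j + 2)
    set R := t ^ ((2 : ℝ) ^ (j + 2) - (j + 8) / 2)
    have hM : t ^ 2 ^ (j + 3) = M * M := by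
      rw [← pow_add]
      ring
    have hR : t ^ ((2 : ℝ) ^ (j + 1 + 2) - ((j + 1 : ℝ) + 8) / 2) = M * R / √t := by
      have hMr : M = t ^ ((2 : ℝ) ^ (j + 2)) := by
        rw [← Nat.cast_ofNat, ← Nat.cast_pow, Real.rpow_natCast]
      rw [eq_div_iff hs0.ne', Real.sqrt_eq_rpow, hMr, ← Real.rpow_add ht0, ← Real.rpow_add ht0]
      congr 1
      ring
    rw [hR, show j + 1 + 2 = j + 3 from rfl, hM]
    rw [hM] at hstep
    have hp0 : (0 : ℝ) < p := by exact_mod_cast (Fact.out : p.Prime).pos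
    have hE : (0 : ℝ) ≤ Eplus Γ := Nat.cast_nonneg _
    calc _ ≤ _ := hstep
      _ ≤ ((2 ^ (j + 1)) * l) ^ 4 * (2 ^ 28 * (M * M / p + M * (2 ^ (4 * (j + 1) + 6) * 2 ^ 28 *
            l ^ 4 * M / p + 16 ^ ((j + 1) ^ 2) * (2 ^ 28) ^ j * l ^ (4 * j) * R * Eplus Γ) /
            √t)) := by gcongr
      _ = 2 ^ (4 * (j + 1)) * 2 ^ 28 * l ^ 4 * (M * M / p) *
            (1 + 2 ^ (4 * j + 10) * 2 ^ 28 * l ^ 4 / √t) +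
          16 ^ (j + 1) * 16 ^ ((j + 1) ^ 2) * (2 ^ 28) ^ (j + 1) * l ^ (4 * (j + 1)) *
            (M * R / √t) * Eplus Γ := by
        rw [show (16 : ℝ) ^ (j + 1) = (2 ^ (j + 1)) ^ 4 by
          rw [← pow_mul, mul_comm, pow_mul]; norm_num]
        field_simp
        ring
      _ ≤ 2 ^ (4 * (j + 1)) * 2 ^ 28 * l ^ 4 * (M * M / p) * 2 ^ 10 +
          16 ^ ((j + 1 + 1) ^ 2) * (2 ^ 28) ^ (j + 1) * l ^ (4 * (j + 1)) *
            (M * R / √t) * Eplus Γ := by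
        have h1 := (div_le_one hs0).mpr hsqrt
        gcongr
        · linarith
        · refine (pow_add _ _ _).symm.trans_le (pow_le_pow_right₀ (by norm_num) ?_)
          nlinarith
      _ ≤ _ := by
        refine le_of_eq ?_
        ring

end Iteration
/-- there is an absolute constant `C ≥ 1` such that for every odd prime `p`,
every multiplicative subgroup `Γ ⊆ F_p^*` and every integer `k ≥ 2` with `2^{64k} C⁴ ≤ |Γ|`,
`T⁺_{2^k}(Γ) ≤ 2^{4k+6} C (log|Γ|)⁴ |Γ|^{2^{k+1}}/p
   + 16^{k²} C^{k−1} (log|Γ|)^{4(k−1)} |Γ|^{2^{k+1}−(k+7)/2} E⁺(Γ)`. -/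
theorem stmt_3 :
    ∃ C : ℝ, 1 ≤ C ∧
      ∀ (p : ℕ) [Fact p.Prime], Odd p →
        ∀ (Γ : Finset (ZMod p)), IsMulSubgroup Γ →
          ∀ k : ℕ, 2 ≤ k → (2 : ℝ) ^ (64 * k) * C ^ 4 ≤ Γ.card →
            (Tplus (2 ^ k) Γ : ℝ) ≤
              2 ^ (4 * k + 6) * C * (Real.logb 2 Γ.card) ^ 4 * (Γ.card : ℝ) ^ (2 ^ (k + 1)) / p
              + 16 ^ (k ^ 2) * C ^ (k - 1) * (Real.logb 2 Γ.card) ^ (4 * (k - 1)) *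
                  (Γ.card : ℝ) ^ ((2 : ℝ) ^ (k + 1) - ((k : ℝ) + 7) / 2) * (Eplus Γ : ℝ) := by
  refine ⟨2 ^ 28, by norm_num, fun p _ _ Γ hΓ k hk hcard => ?_⟩
  obtain ⟨j, rfl⟩ := Nat.exists_eq_add_of_le' (one_le_two.trans hk)
  have hexp : (2 : ℝ) ^ (j + 1 + 1) - (((j + 1 : ℕ) : ℝ) + 7) / 2 = 2 ^ (j + 2) - (j + 8) / 2 := by
    push_cast
    ring
  rw [hexp, Nat.add_sub_cancel]
  exact Tplus_two_pow_le hΓ j hcard
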